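/- arXiv:2103.05565 — 3 statements merged into one kernel-verified Lean document; each statement's English description precedes it below -/
import Mathlib

section
/- Let F be a finite family of nonempty compact convex sets in ℝ² such that every three members of F have a common line transversal (property T(3)). Then there exists a line in ℝ² that intersects at least |F|/3 of the members of F. -/
open Set

/-- The Euclidean plane ℝ². -/
abbrev Plane := EuclideanSpace ℝ (Fin 2)

/-- A line in the plane: a one-dimensional affine subspace of ℝ². -/
def IsLine (l : Set Plane) : Prop :=
  ∃ p v : Plane, v ≠ 0 ∧ l = {x | ∃ t : ℝ, x = p + t • v}

/-- A triple of sets `A, B, C` is tight if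
`conv(A ∪ B) ∩ conv(A ∪ C) ∩ conv(B ∪ C) ≠ ∅`. -/
def Tight (A B C : Set Plane) : Prop :=
  (convexHull ℝ (A ∪ B) ∩ convexHull ℝ (A ∪ C) ∩ convexHull ℝ (B ∪ C)).Nonempty

/-- A family `F` of sets in the plane is pierced by `k` lines if there are `k` lines
such that every member of `F` intersects their union. -/
def PiercedByLines (F : Set (Set Plane)) (k : ℕ) : Prop :=
  ∃ L : Fin k → Set Plane, (∀ i, IsLine (L i)) ∧ ∀ S ∈ F, (S ∩ ⋃ i, L i).Nonempty

section Scarf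
set_option linter.unusedSectionVars false
variable {I T : Type} [Fintype I] [DecidableEq I] [Fintype T] [DecidableEq T]

def ScarfDom (r : I → T → ℕ) (σ : Finset T) : Prop :=
  ∀ y, ∃ i, ∀ x ∈ σ, r i y ≤ r i x

open scoped Classical in
theorem door_two (r : I → T → ℕ) (hr : ∀ i, Function.Injective (r i)) (τ : Finset T)
    (hτ : τ.Nonempty) (hcard : τ.card + 1 = Fintype.card I) (hD : ScarfDom r τ)
    (hM : ∀ k, ∃ y, ∀ l, l ≠ k → ∃ x ∈ τ, r l x < r l y) :
    (Finset.univ.filter (fun y => y ∉ τ ∧ ScarfDom r (insert y τ))).card = 2 := by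
  choose m hm hmin using fun l => Finset.exists_min_image τ (r l) hτ
  have surj : ∀ x ∈ τ, ∃ l, m l = x := by
    intro x hx
    obtain ⟨i, hi⟩ := hD x
    exact ⟨i, hr i (le_antisymm (hmin i x hx) (hi _ (hm i)))⟩
  obtain ⟨i, -, j, -, hij, hmij⟩ : ∃ i ∈ (Finset.univ : Finset I), ∃ j ∈ (Finset.univ : Finset I),
      i ≠ j ∧ m i = m j := by
    apply Finset.exists_ne_map_eq_of_card_lt_of_maps_to (t := τ)
    · rw [Finset.card_univ]; omega
    · intro a _; exact hm a
  have cover : ∀ k, (k = i ∨ k = j) → ∀ x ∈ τ, ∃ l, l ≠ k ∧ m l = x := by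
    intro k hk x hx
    obtain ⟨l, hl⟩ := surj x hx
    by_cases hlk : l = k
    · rcases hk with hk | hk
      · exact ⟨j, by rw [hk]; exact hij.symm, by rw [← hmij, ← hk, ← hlk, hl]⟩
      · exact ⟨i, by rw [hk]; exact hij, by rw [hmij, ← hk, ← hlk, hl]⟩
    · exact ⟨l, hlk, hl⟩
  have only : ∀ k, (∀ x ∈ τ, ∃ l, l ≠ k ∧ m l = x) → k = i ∨ k = j := by
    intro k hk
    by_contra hcon
    push Not at hcon
    have hsub : τ ⊆ ((Finset.univ.erase k).erase j).image m := by
      intro x hx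
      obtain ⟨l, hl, hlx⟩ := hk x hx
      rw [Finset.mem_image]
      by_cases hlj : l = j
      · exact ⟨i, by simp [hij, hcon.1.symm], by rw [hmij, ← hlj, hlx]⟩
      · exact ⟨l, by simp [hl, hlj], hlx⟩
    have h1 := (Finset.card_le_card hsub).trans Finset.card_image_le
    rw [Finset.card_erase_of_mem (by simp [hcon.2.symm]), Finset.card_erase_of_mem (by simp),
      Finset.card_univ] at h1
    have := Finset.card_pos.mpr hτ
    omega
  have hY : ∀ k, ∃ Y, (∀ l, l ≠ k → r l (m l) < r l Y) ∧
      ∀ y, (∀ l, l ≠ k → r l (m l) < r l y) → r k y ≤ r k Y := by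
    intro k
    obtain ⟨y, hy⟩ := hM k
    have hne : (Finset.univ.filter (fun y => ∀ l, l ≠ k → r l (m l) < r l y)).Nonempty := by
      refine ⟨y, ?_⟩
      simp only [Finset.mem_filter, Finset.mem_univ, true_and]
      intro l hl
      obtain ⟨x, hx, hxy⟩ := hy l hl
      exact (hmin l x hx).trans_lt hxy
    obtain ⟨Y, hY, hmax⟩ := Finset.exists_max_image _ (r k) hne
    refine ⟨Y, by simpa using hY, fun y hy => hmax y (by simpa using hy)⟩
  choose Y hY1 hY2 using hY
  have hYk : ∀ k, r k (Y k) ≤ r k (m k) := by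
    intro k
    obtain ⟨l, hl⟩ := hD (Y k)
    by_cases hlk : l = k
    · subst hlk; exact hl _ (hm l)
    · have := hY1 k l hlk
      have := hl _ (hm l)
      omega
  have hYin : ∀ k, (k = i ∨ k = j) → Y k ∉ τ ∧ ScarfDom r (insert (Y k) τ) := by
    intro k hk
    constructor
    · intro hmem
      obtain ⟨l, hl, hlx⟩ := cover k hk _ hmem
      have := hY1 k l hl
      rw [hlx] at this
      exact lt_irrefl _ this
    · intro z
      by_cases hz : ∀ l, l ≠ k → r l (m l) < r l z
      · refine ⟨k, fun x hx => ?_⟩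
        rcases Finset.mem_insert.mp hx with rfl | hx
        · exact hY2 k z hz
        · exact (hY2 k z hz).trans ((hYk k).trans (hmin k x hx))
      · push Not at hz
        obtain ⟨l, hl, hlz⟩ := hz
        refine ⟨l, fun x hx => ?_⟩
        rcases Finset.mem_insert.mp hx with rfl | hx
        · exact hlz.trans (hY1 k l hl).le
        · exact hlz.trans (hmin l x hx)
  have hYne : Y i ≠ Y j := by
    intro h
    have h1 := hY1 j i hij
    have h2 := hYk i
    rw [h] at h2
    omega
  have : (Finset.univ.filter (fun y => y ∉ τ ∧ ScarfDom r (insert y τ))) = {Y i, Y j} := by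
    ext y
    simp only [Finset.mem_filter, Finset.mem_univ, true_and, Finset.mem_insert,
      Finset.mem_singleton]
    constructor
    · rintro ⟨hy, hd⟩
      have hex : ∀ x ∈ insert y τ, ∃ l, ∀ x' ∈ insert y τ, r l x ≤ r l x' := fun x _ => hd x
      obtain ⟨k, hk⟩ := hex y (Finset.mem_insert_self _ _)
      have hkm : ∀ x ∈ τ, ∃ l, l ≠ k ∧ m l = x := by
        intro x hx
        obtain ⟨l, hl⟩ := hex x (Finset.mem_insert_of_mem hx)
        refine ⟨l, ?_, ?_⟩
        · rintro rfl
          have := hr l (le_antisymm (hk x (Finset.mem_insert_of_mem hx))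
            (hl y (Finset.mem_insert_self _ _)))
          exact hy (this ▸ hx)
        · exact hr l (le_antisymm (hmin l x hx) (hl _ (Finset.mem_insert_of_mem (hm l))))
      have hkij := only k hkm
      -- every other index has its minimum in the door
      have hyM : ∀ l, l ≠ k → r l (m l) < r l y := by
        intro l hl
        by_contra hcon
        push Not at hcon
        -- then y is minimal for both l and k, too few minima
        have hall : ∀ x ∈ τ, ∃ p, p ≠ k ∧ p ≠ l ∧ m p = x := by
          intro x hx
          obtain ⟨p, hp⟩ := hex x (Finset.mem_insert_of_mem hx)
          have hpx : m p = x :=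
            hr p (le_antisymm (hmin p x hx) (hp _ (Finset.mem_insert_of_mem (hm p))))
          have hne : ∀ q, (∀ x ∈ τ, r q y ≤ r q x) → p ≠ q := by
            rintro q hq rfl
            have := hr p (le_antisymm (hq x hx) (hp y (Finset.mem_insert_self _ _)))
            exact hy (this ▸ hx)
          exact ⟨p, hne k (fun x hx => hk x (Finset.mem_insert_of_mem hx)),
            hne l (fun x hx => hcon.trans (hmin l x hx)), hpx⟩
        have hsub : τ ⊆ ((Finset.univ.erase k).erase l).image m := by
          intro x hx
          obtain ⟨p, h1, h2, h3⟩ := hall x hx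
          exact Finset.mem_image.mpr ⟨p, by simp [h1, h2], h3⟩
        have h1 := (Finset.card_le_card hsub).trans Finset.card_image_le
        rw [Finset.card_erase_of_mem (by simp [hl]), Finset.card_erase_of_mem (by simp),
          Finset.card_univ] at h1
        have := Finset.card_pos.mpr hτ
        omega
      have hyY : y = Y k := by
        apply hr k
        apply le_antisymm (hY2 k y hyM)
        obtain ⟨l, hl⟩ := hd (Y k)
        by_cases hlk : l = k
        · subst hlk; exact hl y (Finset.mem_insert_self _ _)
        · have h1 := hY1 k l hlk
          have h2 := hl (m l) (Finset.mem_insert_of_mem (hm l))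
          omega
      rcases hkij with h | h
      · left; rw [hyY, h]
      · right; rw [hyY, h]
    · rintro (rfl | rfl)
      · exact hYin i (Or.inl rfl)
      · exact hYin j (Or.inr rfl)
  rw [this, Finset.card_pair hYne]

theorem room_even (c : T → I) (i0 : I) (σ : Finset T) (hcard : σ.card = Fintype.card I)
    (hσ : σ.image c ≠ Finset.univ) :
    Even (σ.filter (fun x => (σ.erase x).image c = Finset.univ.erase i0)).card := by
  by_cases hemp : (σ.filter (fun x => (σ.erase x).image c = Finset.univ.erase i0)) = ∅
  · rw [hemp]; simp
  obtain ⟨x, hx⟩ := Finset.nonempty_iff_ne_empty.mpr hemp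
  rw [Finset.mem_filter] at hx
  obtain ⟨hxσ, hx⟩ := hx
  have hcx : c x ≠ i0 := by
    intro h
    apply hσ
    rw [← Finset.insert_erase hxσ, Finset.image_insert, hx, h]
    simp
  have : c x ∈ (σ.erase x).image c := by rw [hx]; simp [hcx]
  obtain ⟨x', hx', hcc⟩ := Finset.mem_image.mp this
  have hx'σ := Finset.mem_of_mem_erase hx'
  have hxx' : x' ≠ x := Finset.ne_of_mem_erase hx'
  have hinj : Set.InjOn c (σ.erase x) := by
    apply Finset.injOn_of_card_image_eq
    rw [hx, Finset.card_erase_of_mem (by simp), Finset.card_erase_of_mem hxσ, hcard,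
      Finset.card_univ]
  have : (σ.filter (fun x => (σ.erase x).image c = Finset.univ.erase i0)) = {x, x'} := by
    ext z
    simp only [Finset.mem_filter, Finset.mem_insert, Finset.mem_singleton]
    constructor
    · rintro ⟨hz, hzi⟩
      by_contra hcon
      push Not at hcon
      have hzx : z ∈ σ.erase x := Finset.mem_erase.mpr ⟨hcon.1, hz⟩
      have h1 : c z ∈ (σ.erase z).image c := by
        rw [hzi, ← hx]; exact Finset.mem_image_of_mem c hzx
      obtain ⟨w, hw, hwz⟩ := Finset.mem_image.mp h1
      by_cases hwx : w = x
      · apply hcon.2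
        apply hinj hzx hx'
        rw [hcc, ← hwz, hwx]
      · exact Finset.ne_of_mem_erase hw (hinj
          (Finset.mem_coe.mpr (Finset.mem_erase.mpr ⟨hwx, Finset.mem_of_mem_erase hw⟩)) hzx hwz)
    · rintro (rfl | rfl)
      · exact ⟨hxσ, hx⟩
      · refine ⟨hx'σ, ?_⟩
        rw [← hx]
        ext a
        simp only [Finset.mem_image, Finset.mem_erase]
        constructor
        · rintro ⟨w, ⟨h1, h2⟩, h3⟩
          by_cases hwx : w = x
          · exact ⟨z, ⟨hxx', hx'σ⟩, by rw [hcc, ← hwx, h3]⟩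
          · exact ⟨w, ⟨hwx, h2⟩, h3⟩
        · rintro ⟨w, ⟨h1, h2⟩, h3⟩
          by_cases hwx : w = z
          · exact ⟨x, ⟨hxx'.symm, hxσ⟩, by rw [← hcc, ← hwx, h3]⟩
          · exact ⟨w, ⟨hwx, h2⟩, h3⟩
  rw [this, Finset.card_pair hxx'.symm]
  exact even_two

open scoped Classical in
theorem scarf (hI : 1 < Fintype.card I) (r : I → T → ℕ) (hr : ∀ i, Function.Injective (r i))
    (s : I → T) (c : T → I) (hc : ∀ i, c (s i) = i) (t0 : T) (ht0 : ∀ i, s i ≠ t0)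
    (hmin : ∀ i t, r i (s i) ≤ r i t)
    (hmax : ∀ i k t, k ≠ i → (∀ q, s q ≠ t) → r i t < r i (s k)) :
    ∃ σ : Finset T, ScarfDom r σ ∧ σ.image c = Finset.univ := by
  by_contra hno
  push Not at hno
  have hsinj : Function.Injective s := fun a b h => by rw [← hc a, h, hc b]
  obtain ⟨i0⟩ : Nonempty I := Fintype.card_pos_iff.mp (by omega)
  set Dr : Finset (Finset T) := Finset.univ.filter (fun τ => ScarfDom r τ ∧
    τ.card + 1 = Fintype.card I ∧ τ.image c = Finset.univ.erase i0) with hDr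
  set Rm : Finset (Finset T) := Finset.univ.filter (fun σ => ScarfDom r σ ∧
    σ.card = Fintype.card I) with hRm
  set P1 := Dr.sigma (fun τ => Finset.univ.filter (fun y => y ∉ τ ∧ ScarfDom r (insert y τ)))
    with hP1
  set P2 := Rm.sigma (fun σ => σ.filter (fun x => (σ.erase x).image c = Finset.univ.erase i0))
    with hP2
  have hcards : P1.card = P2.card := by
    refine Finset.card_bij' (fun p _ => ⟨insert p.2 p.1, p.2⟩) (fun p _ => ⟨p.1.erase p.2, p.2⟩)
      ?_ ?_ ?_ ?_
    · rintro ⟨τ, y⟩ h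
      simp only [hP1, hDr, Finset.mem_sigma, Finset.mem_filter, Finset.mem_univ, true_and] at h
      obtain ⟨⟨h1, h2, h3⟩, h4, h5⟩ := h
      simp only [hP2, hRm, Finset.mem_sigma, Finset.mem_filter, Finset.mem_univ, true_and]
      refine ⟨⟨h5, ?_⟩, Finset.mem_insert_self _ _, ?_⟩
      · rw [Finset.card_insert_of_notMem h4, h2]
      · rw [Finset.erase_insert h4, h3]
    · rintro ⟨σ, x⟩ h
      simp only [hP2, hRm, Finset.mem_sigma, Finset.mem_filter, Finset.mem_univ, true_and] at h
      obtain ⟨⟨h1, h2⟩, h3, h4⟩ := h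
      simp only [hP1, hDr, Finset.mem_sigma, Finset.mem_filter, Finset.mem_univ, true_and]
      refine ⟨⟨?_, ?_, h4⟩, Finset.notMem_erase _ _, ?_⟩
      · intro y
        obtain ⟨i, hi⟩ := h1 y
        exact ⟨i, fun z hz => hi z (Finset.mem_of_mem_erase hz)⟩
      · rw [Finset.card_erase_add_one h3, h2]
      · rw [Finset.insert_erase h3]; exact h1
    · rintro ⟨τ, y⟩ h
      simp only [hP1, hDr, Finset.mem_sigma, Finset.mem_filter, Finset.mem_univ, true_and] at h
      simp only [Finset.erase_insert h.2.1]
    · rintro ⟨σ, x⟩ h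
      simp only [hP2, hRm, Finset.mem_sigma, Finset.mem_filter, Finset.mem_univ, true_and] at h
      simp only [Finset.insert_erase h.2.1]
  have hev : Even P2.card := by
    rw [hP2, Finset.card_sigma]
    apply Finset.even_sum
    intro σ hσ
    simp only [hRm, Finset.mem_filter, Finset.mem_univ, true_and] at hσ
    exact room_even c i0 σ hσ.2 (hno σ hσ.1)
  set τ0 : Finset T := (Finset.univ.erase i0).image s with hτ0
  have hτ0c : τ0.image c = Finset.univ.erase i0 := by
    rw [hτ0, Finset.image_image]
    have : c ∘ s = id := funext hc
    rw [this, Finset.image_id]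
  have hother : ∀ i, i ≠ i0 → ∃ l, l ≠ i ∧ True := fun i hi => ⟨i0, hi.symm, trivial⟩
  obtain ⟨ym, hym, hymax⟩ := Finset.exists_max_image
    (Finset.univ.filter (fun t => ∀ q, s q ≠ t)) (r i0) ⟨t0, by simpa using ht0⟩
  simp only [Finset.mem_filter, Finset.mem_univ, true_and] at hym hymax
  have hDym : ScarfDom r (insert ym τ0) := by
    intro z
    by_cases hz : ∃ q, s q = z
    · obtain ⟨q, rfl⟩ := hz
      exact ⟨q, fun x _ => hmin q x⟩
    · push Not at hz
      refine ⟨i0, fun x hx => ?_⟩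
      rcases Finset.mem_insert.mp hx with rfl | hx
      · exact hymax z hz
      · obtain ⟨k, hk, rfl⟩ := Finset.mem_image.mp hx
        exact (hmax i0 k z (Finset.ne_of_mem_erase hk) hz).le
  have hτ0D : τ0 ∈ Dr := by
    simp only [hDr, Finset.mem_filter, Finset.mem_univ, true_and]
    refine ⟨?_, ?_, hτ0c⟩
    · intro y
      obtain ⟨i, hi⟩ := hDym y
      exact ⟨i, fun z hz => hi z (Finset.mem_insert_of_mem hz)⟩
    · rw [hτ0, Finset.card_image_of_injective _ hsinj, Finset.card_erase_of_mem (by simp),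
        Finset.card_univ]
      omega
  have hlow : ∀ i t, (∀ q, s q ≠ t) → r i (s i) < r i t := by
    intro i t ht
    exact lt_of_le_of_ne (hmin i t) (fun h => ht i (hr i h))
  have hone : (Finset.univ.filter (fun y => y ∉ τ0 ∧ ScarfDom r (insert y τ0))).card = 1 := by
    rw [Finset.card_eq_one]
    refine ⟨ym, ?_⟩
    ext y
    simp only [Finset.mem_filter, Finset.mem_univ, true_and, Finset.mem_singleton]
    constructor
    · rintro ⟨hy, hd⟩
      obtain ⟨l, hl⟩ := hd ym
      have hli : l = i0 := by
        by_contra hne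
        have := hl (s l) (Finset.mem_insert_of_mem (Finset.mem_image_of_mem s (by simp [hne])))
        have := hlow l ym hym
        omega
      subst hli
      have h1 := hl y (Finset.mem_insert_self _ _)
      by_cases hys : ∃ q, s q = y
      · obtain ⟨q, rfl⟩ := hys
        exfalso
        by_cases hq : q = l
        · subst hq
          have := hlow q ym hym
          omega
        · exact hy (Finset.mem_image_of_mem s (by simp [hq]))
      · push Not at hys
        exact hr l (le_antisymm (hymax y hys) h1)
    · rintro rfl
      refine ⟨?_, hDym⟩
      intro h
      obtain ⟨k, -, hk⟩ := Finset.mem_image.mp h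
      exact hym k hk
  have hodd : Odd P1.card := by
    rw [hP1, Finset.card_sigma, ← Finset.add_sum_erase _ _ hτ0D, hone]
    apply Even.one_add
    apply Finset.even_sum
    intro τ hτ
    have hne := Finset.ne_of_mem_erase hτ
    have hτ := Finset.mem_of_mem_erase hτ
    simp only [hDr, Finset.mem_filter, Finset.mem_univ, true_and] at hτ
    obtain ⟨h1, h2, h3⟩ := hτ
    rw [door_two r hr τ (Finset.card_pos.mp (by omega)) h2 h1]
    · exact even_two
    · have hex : ∃ x ∈ τ, ∀ q, s q ≠ x := by
        by_contra hcon
        push Not at hcon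
        apply hne
        ext x
        constructor
        · intro hx
          obtain ⟨q, rfl⟩ := hcon x hx
          have : c (s q) ∈ τ.image c := Finset.mem_image_of_mem c hx
          rw [h3, hc] at this
          exact Finset.mem_image_of_mem s this
        · intro hx
          obtain ⟨k, hk, rfl⟩ := Finset.mem_image.mp hx
          rw [← h3] at hk
          obtain ⟨w, hw, hwk⟩ := Finset.mem_image.mp hk
          obtain ⟨q, rfl⟩ := hcon w hw
          rw [hc] at hwk
          rwa [← hwk]
      obtain ⟨x, hx, hxs⟩ := hex
      intro k
      exact ⟨s k, fun l hl => ⟨x, hx, hmax l k x hl.symm hxs⟩⟩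
  rw [hcards] at hodd
  exact (Nat.not_even_iff_odd.mpr hodd) hev

end Scarf

abbrev GridPt (N : ℕ) := {x : Fin 6 → Fin (N + 1) // ∑ i, (x i : ℕ) = N}

def gridX (N : ℕ) : GridPt N ⊕ Fin 6 → Fin 6 → ℕ
  | Sum.inl x, i => (x.1 i : ℕ) + 1
  | Sum.inr k, i => if k = i then 0 else N + 2

theorem grid_scarf (N : ℕ) (c : GridPt N → Fin 6) :
    ∃ (σ : Finset (GridPt N)) (C : Finset (Fin 6)), σ.Nonempty ∧ (∀ i ∈ C, ∃ x ∈ σ, c x = i) ∧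
      (∀ x ∈ σ, ∀ i, i ∉ C → (x.1 i : ℕ) ≤ 4) ∧
      (∀ x ∈ σ, ∀ x' ∈ σ, ∀ i, (x.1 i : ℕ) ≤ (x'.1 i : ℕ) + 5) := by
  classical
  set M := Fintype.card (GridPt N ⊕ Fin 6) with hM
  let e : GridPt N ⊕ Fin 6 ≃ Fin M := Fintype.equivFin _
  let r : Fin 6 → GridPt N ⊕ Fin 6 → ℕ := fun i t => gridX N t i * M + e t
  have hlt : ∀ i t t', gridX N t i < gridX N t' i → r i t < r i t' := by
    intro i t t' h
    have h1 : (gridX N t i + 1) * M ≤ gridX N t' i * M := Nat.mul_le_mul_right _ h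
    have h2 := (e t).2
    simp only [r]
    rw [Nat.add_mul] at h1
    omega
  have hle : ∀ i t t', r i t ≤ r i t' → gridX N t i ≤ gridX N t' i := by
    intro i t t' h
    by_contra hcon
    push Not at hcon
    have := hlt i _ _ hcon
    omega
  have hr : ∀ i, Function.Injective (r i) := by
    intro i t t' h
    have h1 := hle i t t' h.le
    have h2 := hle i t' t h.ge
    have h3 : gridX N t i = gridX N t' i := le_antisymm h1 h2
    simp only [r, h3] at h
    apply e.injective
    apply Fin.ext
    omega
  let x0 : GridPt N := ⟨fun i => if i = 0 then Fin.last N else 0, by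
    simp [Fin.sum_univ_succ]⟩
  have hgb : ∀ (x : GridPt N) i, (x.1 i : ℕ) ≤ N := fun x i => Nat.lt_succ_iff.mp (x.1 i).2
  obtain ⟨ρ, hD, himg⟩ := scarf (by simp) r hr Sum.inr (Sum.elim c id) (by simp) (Sum.inl x0)
    (by simp)
    (by
      intro i t
      by_cases h : Sum.inr i = t
      · rw [h]
      · apply (hlt i _ _ _).le
        rcases t with x | k
        · simp [gridX]
        · have : k ≠ i := fun hk => h (by rw [hk])
          simp [gridX, this])
    (by
      intro i k t hk ht
      apply hlt
      rcases t with x | q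
      · have := hgb x i
        simp only [gridX, hk, if_false]
        omega
      · exact absurd rfl (ht q))
  set σ : Finset (GridPt N) := Finset.univ.filter (fun x => Sum.inl x ∈ ρ) with hσ
  set C : Finset (Fin 6) := Finset.univ.filter (fun i => Sum.inr i ∉ ρ) with hC
  have hρ : ρ.Nonempty := by
    rw [← Finset.image_nonempty (f := Sum.elim c id), himg]; exact Finset.univ_nonempty
  choose m hm hmin using fun i => Finset.exists_min_image ρ (fun t => gridX N t i) hρ
  have hlow : ∀ y : GridPt N, ∃ i, (y.1 i : ℕ) + 1 ≤ gridX N (m i) i := by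
    intro y
    obtain ⟨i, hi⟩ := hD (Sum.inl y)
    exact ⟨i, hle i _ _ (hi _ (hm i))⟩
  have hsum : N + 1 ≤ ∑ i, gridX N (m i) i := by
    by_contra hcon
    push Not at hcon
    set w : Fin 6 → ℕ := fun i => gridX N (m i) i with hw
    have hs : ∑ i, w i = w 0 + ∑ i : Fin 5, w i.succ := Fin.sum_univ_succ w
    have hcon2 : w 0 + ∑ i : Fin 5, w i.succ ≤ N := by
      rw [← hs]; exact Nat.lt_succ_iff.mp hcon
    let y : Fin 6 → ℕ := Fin.cons (N - ∑ i : Fin 5, w i.succ) (fun i => w i.succ)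
    have hyw : ∀ i, w i ≤ y i := by
      intro i
      refine Fin.cases ?_ (fun j => ?_) i
      · simp only [y, Fin.cons_zero]; omega
      · simp only [y, Fin.cons_succ]; exact le_rfl
    have hys : ∑ i, y i = N := by
      rw [Fin.sum_univ_succ]
      simp only [y, Fin.cons_zero, Fin.cons_succ]; omega
    have hyN : ∀ i, y i < N + 1 := by
      intro i
      have := Finset.single_le_sum (f := y) (fun _ _ => Nat.zero_le _) (Finset.mem_univ i)
      omega
    obtain ⟨i, hi⟩ := hlow ⟨fun i => ⟨y i, hyN i⟩, by simpa using hys⟩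
    have := hyw i
    simp only [hw] at this
    simp only at hi
    omega
  have hx1 : ∀ x ∈ σ, ∀ i, gridX N (m i) i ≤ (x.1 i : ℕ) + 1 := by
    intro x hx i
    exact hmin i (Sum.inl x) (by simpa [hσ] using hx)
  have hx2 : ∀ x ∈ σ, ∀ i, (x.1 i : ℕ) ≤ gridX N (m i) i + 4 := by
    intro x hx i
    have h1 := hx1 x hx
    have h2 : ∑ j ∈ Finset.univ.erase i, gridX N (m j) j ≤
        ∑ j ∈ Finset.univ.erase i, ((x.1 j : ℕ) + 1) := Finset.sum_le_sum (fun j _ => h1 j)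
    have h3 := Finset.add_sum_erase Finset.univ (fun j => gridX N (m j) j) (Finset.mem_univ i)
    have h4 := Finset.add_sum_erase Finset.univ (fun j => ((x.1 j : ℕ) + 1)) (Finset.mem_univ i)
    have h5 : ∑ j, ((x.1 j : ℕ) + 1) = N + 6 := by
      rw [Finset.sum_add_distrib, x.2]; simp
    omega
  refine ⟨σ, C, ?_, ?_, ?_, ?_⟩
  · by_contra hemp
    rw [Finset.not_nonempty_iff_eq_empty] at hemp
    have hall : ∀ k, Sum.inr k ∈ ρ := by
      intro k
      have : k ∈ ρ.image (Sum.elim c id) := by rw [himg]; simp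
      obtain ⟨t, ht, htk⟩ := Finset.mem_image.mp this
      rcases t with x | q
      · have : x ∈ σ := by simpa [hσ] using ht
        rw [hemp] at this; simp at this
      · simp at htk; rwa [← htk]
    obtain ⟨i, hi⟩ := hlow x0
    have := hmin i _ (hall i)
    rw [show gridX N (Sum.inr i) i = 0 by simp [gridX]] at this
    omega
  · intro i hi
    have : i ∈ ρ.image (Sum.elim c id) := by rw [himg]; simp
    obtain ⟨t, ht, htk⟩ := Finset.mem_image.mp this
    rcases t with x | q
    · exact ⟨x, by simpa [hσ] using ht, by simpa using htk⟩
    · simp at htk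
      subst htk
      simp [hC] at hi
      exact absurd ht hi
  · intro x hx i hi
    have hi' : Sum.inr i ∈ ρ := by simpa [hC] using hi
    have h1 := hmin i _ hi'
    rw [show gridX N (Sum.inr i) i = 0 by simp [gridX]] at h1
    have := hx2 x hx i
    omega
  · intro x hx x' hx' i
    have := hx2 x hx i
    have := hx1 x' hx' i
    omega

theorem kkm_six (A : Fin 6 → Set (Fin 6 → ℝ)) (hA : ∀ i, IsOpen (A i))
    (hcov : ∀ x ∈ stdSimplex ℝ (Fin 6), ∃ i, x ∈ A i)
    (hbd : ∀ x ∈ stdSimplex ℝ (Fin 6), ∀ i, x i = 0 → x ∉ A i) :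
    ∃ x ∈ stdSimplex ℝ (Fin 6), ∀ i, x ∈ A i := by
  by_contra hno
  push Not at hno
  obtain ⟨δ, hδ, hleb⟩ := lebesgue_number_lemma_of_metric (isCompact_stdSimplex ℝ (Fin 6)) hA
    (fun x hx => Set.mem_iUnion.mpr (hcov x hx))
  obtain ⟨N, hN⟩ := exists_nat_gt (5 / δ)
  have hN0 : (0 : ℝ) < N := lt_trans (by positivity) hN
  have h5 : 5 / (N : ℝ) < δ := by
    rw [div_lt_iff₀ hδ] at hN
    rw [div_lt_iff₀ hN0]; linarith
  let p : GridPt N → Fin 6 → ℝ := fun x i => (x.1 i : ℕ) / (N : ℝ)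
  have hp : ∀ x, p x ∈ stdSimplex ℝ (Fin 6) := by
    intro x
    refine ⟨fun i => by positivity, ?_⟩
    simp only [p]
    rw [← Finset.sum_div, ← Nat.cast_sum, x.2, div_self hN0.ne']
  choose c hc using fun x => hno (p x) (hp x)
  obtain ⟨σ, C, ⟨x, hx⟩, h1, h2, h3⟩ := grid_scarf N c
  obtain ⟨i, hi⟩ := hleb (p x) (hp x)
  by_cases hiC : i ∈ C
  · obtain ⟨x', hx', hxi⟩ := h1 i hiC
    apply hc x'
    rw [hxi]
    apply hi
    rw [Metric.mem_ball, dist_pi_lt_iff hδ]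
    intro j
    refine lt_of_le_of_lt ?_ h5
    have a1 : ((x.1 j : ℕ) : ℝ) ≤ (x'.1 j : ℕ) + 5 := by exact_mod_cast h3 x hx x' hx' j
    have a2 : ((x'.1 j : ℕ) : ℝ) ≤ (x.1 j : ℕ) + 5 := by exact_mod_cast h3 x' hx' x hx j
    simp only [p]
    rw [Real.dist_eq, ← sub_div, abs_div, abs_of_pos hN0]
    gcongr
    rw [abs_le]; constructor <;> linarith
  · have a1 : ((x.1 i : ℕ) : ℝ) ≤ 4 := by exact_mod_cast h2 x hx i hiC
    obtain ⟨k, hk⟩ : ∃ k : Fin 6, k ≠ i := exists_ne i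
    have hpi : p x i ≤ 4 / N := by simp only [p]; gcongr
    have hpi0 : 0 ≤ p x i := (hp x).1 i
    have h45 : 4 / (N : ℝ) ≤ 5 / N := by gcongr; norm_num
    let q : Fin 6 → ℝ := p x - Pi.single i (p x i) + Pi.single k (p x i)
    have hq : q ∈ stdSimplex ℝ (Fin 6) := by
      constructor
      · intro j
        have := (hp x).1 j
        by_cases hji : j = i
        · subst hji; simp [q, hk.symm]
        · by_cases hjk : j = k
          · subst hjk; simp [q, hji]; linarith
          · simp [q, hji, hjk]; exact this
      · have := (hp x).2
        simp only [q, Pi.add_apply, Pi.sub_apply, Finset.sum_add_distrib, Finset.sum_sub_distrib,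
          Finset.sum_pi_single', Finset.mem_univ, if_true, this]
        simp
    apply hbd q hq i (by simp [q, hk.symm])
    apply hi
    rw [Metric.mem_ball, dist_pi_lt_iff hδ]
    intro j
    refine lt_of_le_of_lt ?_ h5
    rw [Real.dist_eq]
    by_cases hji : j = i
    · subst hji; simp [q, hk.symm]; rw [abs_of_nonneg hpi0]; linarith
    · by_cases hjk : j = k
      · subst hjk; simp [q, hji]; rw [abs_of_nonneg hpi0]; linarith
      · simp [q, hji, hjk]; positivity

noncomputable def chordFn (R s t : ℝ) (q : Plane) : ℝ :=
  q 0 * Real.cos (Real.pi * (s + t)) + q 1 * Real.sin (Real.pi * (s + t))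
    - R * Real.cos (Real.pi * (t - s))

theorem chordFn_flip (R s t : ℝ) (q : Plane) : chordFn R t (s + 1) q = - chordFn R s t q := by
  unfold chordFn
  rw [show Real.pi * (t + (s + 1)) = Real.pi * (s + t) + Real.pi by ring,
    show Real.pi * (s + 1 - t) = Real.pi - Real.pi * (t - s) by ring, Real.cos_add_pi,
    Real.sin_add_pi, Real.cos_pi_sub]
  ring

theorem chordFn_shift (R s t : ℝ) (q : Plane) : chordFn R (s + 1) (t + 1) q = chordFn R s t q := by
  rw [chordFn_flip, chordFn_flip, neg_neg]

theorem dot_lt (R a : ℝ) (q : Plane) (hq : ‖q‖ < R) :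
    q 0 * Real.cos a + q 1 * Real.sin a < R := by
  have h1 := EuclideanSpace.real_norm_sq_eq q
  rw [Fin.sum_univ_two] at h1
  have h2 := Real.sin_sq_add_cos_sq a
  have h3 : (q 0 * Real.cos a + q 1 * Real.sin a) ^ 2 ≤ ‖q‖ ^ 2 := by
    have : ‖q‖ ^ 2 = (q 0 ^ 2 + q 1 ^ 2) * (Real.sin a ^ 2 + Real.cos a ^ 2) := by
      rw [h1, h2, mul_one]
    rw [this]
    nlinarith [sq_nonneg (q 0 * Real.sin a - q 1 * Real.cos a)]
  exact (abs_le_of_sq_le_sq' h3 (norm_nonneg q)).2.trans_lt hq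

theorem chordFn_nest (R s t t' : ℝ) (q : Plane) (hq : ‖q‖ < R) (h1 : s ≤ t) (h2 : t ≤ t')
    (h3 : t' ≤ s + 1) (hp : 0 < chordFn R s t q) (hn : chordFn R s t' q < 0) : False := by
  have hα := dot_lt R (2 * (Real.pi * s)) q hq
  set e0 := Real.cos (2 * (Real.pi * s)) with he0
  set e1 := Real.sin (2 * (Real.pi * s)) with he1
  have key : ∀ u, chordFn R s u q = (q 1 * e0 - q 0 * e1) * Real.sin (Real.pi * (u - s))
      - (R - (q 0 * e0 + q 1 * e1)) * Real.cos (Real.pi * (u - s)) := by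
    intro u
    unfold chordFn
    rw [show Real.pi * (s + u) = 2 * (Real.pi * s) + Real.pi * (u - s) by ring, Real.cos_add,
      Real.sin_add]
    ring
  rw [key] at hp hn
  set α := R - (q 0 * e0 + q 1 * e1)
  set β := q 1 * e0 - q 0 * e1
  have hα : 0 < α := by simp only [α]; linarith
  have hpi := Real.pi_pos
  have s1 : 0 ≤ Real.sin (Real.pi * (t - s)) :=
    Real.sin_nonneg_of_nonneg_of_le_pi (mul_nonneg hpi.le (by linarith)) (by nlinarith)
  have s2 : 0 ≤ Real.sin (Real.pi * (t' - s)) :=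
    Real.sin_nonneg_of_nonneg_of_le_pi (mul_nonneg hpi.le (by linarith)) (by nlinarith)
  have s3 : 0 ≤ Real.sin (Real.pi * (t' - t)) :=
    Real.sin_nonneg_of_nonneg_of_le_pi (mul_nonneg hpi.le (by linarith)) (by nlinarith)
  rw [show Real.pi * (t' - t) = Real.pi * (t' - s) - Real.pi * (t - s) by ring,
    Real.sin_sub] at s3
  rcases s1.eq_or_lt with h0 | h0
  · -- degenerate start
    by_cases hts : t = s
    · subst hts
      simp at hp
      linarith
    · have htt : t = s + 1 := by
        by_contra hne
        have hlt : t < s + 1 := lt_of_le_of_ne (h2.trans h3) hne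
        have hgt : s < t := lt_of_le_of_ne h1 (Ne.symm hts)
        have := Real.sin_pos_of_pos_of_lt_pi (x := Real.pi * (t - s))
          (mul_pos hpi (by linarith)) (by nlinarith)
        linarith
      have : t' = t := le_antisymm (by linarith) h2
      rw [this] at hn
      linarith
  · nlinarith [mul_nonneg hα.le s3, mul_nonneg hp.le s2, mul_pos (neg_pos.mpr hn) h0]

theorem chordFn_line (R s t : ℝ) : IsLine {q | chordFn R s t q = 0} := by
  set a := Real.pi * (s + t) with ha
  set ρ := R * Real.cos (Real.pi * (t - s)) with hρ
  have h2 := Real.sin_sq_add_cos_sq a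
  refine ⟨!₂[ρ * Real.cos a, ρ * Real.sin a], !₂[-Real.sin a, Real.cos a], ?_, ?_⟩
  · intro h
    have e0 := congrArg (fun v : Plane => v 0) h
    have e1 := congrArg (fun v : Plane => v 1) h
    simp at e0 e1
    rw [e0, e1] at h2
    norm_num at h2
  · ext q
    simp only [Set.mem_setOf_eq, chordFn]
    rw [← ha, ← hρ]
    constructor
    · intro h
      refine ⟨- q 0 * Real.sin a + q 1 * Real.cos a, ?_⟩
      have hr : ρ = q 0 * Real.cos a + q 1 * Real.sin a := by linarith
      ext i
      fin_cases i
      · simp [hr]; linear_combination (-(q 0)) * h2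
      · simp [hr]; linear_combination (-(q 1)) * h2
    · rintro ⟨τ, rfl⟩
      simp
      linear_combination ρ * h2

theorem chordFn_comb (R s t : ℝ) (a b : Plane) (x y : ℝ) (hxy : x + y = 1) :
    chordFn R s t (x • a + y • b) = x * chordFn R s t a + y * chordFn R s t b := by
  have : y = 1 - x := by linarith
  subst this
  simp [chordFn]
  ring

theorem seg_pos (R s t : ℝ) (a b m : Plane) (hm : m ∈ segment ℝ a b)
    (ha : 0 < chordFn R s t a) (hb : 0 < chordFn R s t b) : 0 < chordFn R s t m := by
  obtain ⟨x, y, hx, hy, hxy, rfl⟩ := hm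
  rw [chordFn_comb _ _ _ _ _ _ _ hxy]
  rcases hx.eq_or_lt with h | h
  · rw [← h] at hxy ⊢
    have : y = 1 := by linarith
    rw [this]; linarith
  · have := mul_pos h ha
    have := mul_nonneg hy hb.le
    linarith

theorem seg_neg (R s t : ℝ) (a b m : Plane) (hm : m ∈ segment ℝ a b)
    (ha : chordFn R s t a < 0) (hb : chordFn R s t b < 0) : chordFn R s t m < 0 := by
  have := seg_pos R t (s + 1) a b m hm (by rw [chordFn_flip]; linarith)
    (by rw [chordFn_flip]; linarith)
  rw [chordFn_flip] at this
  linarith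

theorem line_seg (P v : Plane) (a b c : ℝ) (h1 : a ≤ b) (h2 : b ≤ c) :
    P + b • v ∈ segment ℝ (P + a • v) (P + c • v) := by
  rcases h1.eq_or_lt with h | h
  · rw [h]; exact left_mem_segment _ _ _
  have hca : 0 < c - a := by linarith
  refine ⟨(c - b) / (c - a), (b - a) / (c - a), div_nonneg (by linarith) hca.le,
    div_nonneg (by linarith) hca.le, ?_, ?_⟩
  · field_simp; ring
  · ext i
    simp
    field_simp
    ring

theorem line3 (l : Set Plane) (hl : IsLine l) (p q r : Plane) (hp : p ∈ l) (hq : q ∈ l)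
    (hr : r ∈ l) : p ∈ segment ℝ q r ∨ q ∈ segment ℝ p r ∨ r ∈ segment ℝ p q := by
  obtain ⟨P, v, -, rfl⟩ := hl
  obtain ⟨a, rfl⟩ := hp
  obtain ⟨b, rfl⟩ := hq
  obtain ⟨c, rfl⟩ := hr
  rcases le_total a b with h1 | h1 <;> rcases le_total b c with h2 | h2 <;>
    rcases le_total a c with h3 | h3
  · exact Or.inr (Or.inl (line_seg P v a b c h1 h2))
  · exact Or.inr (Or.inl (line_seg P v a b c h1 h2))
  · exact Or.inr (Or.inr (line_seg P v a c b h3 h2))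
  · left; rw [segment_symm]; exact line_seg P v c a b h3 h1
  · exact Or.inl (line_seg P v b a c h1 h3)
  · right; right; rw [segment_symm]; exact line_seg P v b c a h2 h3
  · right; left; rw [segment_symm]; exact line_seg P v c b a h2 h1
  · right; left; rw [segment_symm]; exact line_seg P v c b a h2 h1

theorem const_sign (h : Plane → ℝ) (hc : Continuous h) (S : Set Plane) (hS : Convex ℝ S)
    (hne : ∀ q ∈ S, h q ≠ 0) : (∀ q ∈ S, 0 < h q) ∨ (∀ q ∈ S, h q < 0) := by
  by_contra hcon
  push Not at hcon
  obtain ⟨⟨a, ha, ha0⟩, ⟨b, hb, hb0⟩⟩ := hcon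
  obtain ⟨z, hz, hz0⟩ := hS.isPreconnected.intermediate_value ha hb hc.continuousOn
    (show (0 : ℝ) ∈ Set.Icc (h a) (h b) from ⟨ha0, hb0⟩)
  exact hne z hz hz0

noncomputable def hh0 (R : ℝ) (x : Fin 6 → ℝ) (q : Plane) : ℝ :=
  chordFn R 0 (x 0 + x 1 + x 2) q
noncomputable def hh1 (R : ℝ) (x : Fin 6 → ℝ) (q : Plane) : ℝ :=
  chordFn R (x 0) (x 0 + x 1 + x 2 + x 3) q
noncomputable def hh2 (R : ℝ) (x : Fin 6 → ℝ) (q : Plane) : ℝ :=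
  chordFn R (x 0 + x 1) (x 0 + x 1 + x 2 + x 3 + x 4) q

noncomputable def wA (R : ℝ) (x : Fin 6 → ℝ) (q : Plane) : Fin 6 → ℝ :=
  ![hh0 R x q, hh1 R x q, hh2 R x q, - hh0 R x q, - hh1 R x q, - hh2 R x q]
noncomputable def wB (R : ℝ) (x : Fin 6 → ℝ) (q : Plane) : Fin 6 → ℝ :=
  ![- hh1 R x q, - hh2 R x q, hh0 R x q, hh1 R x q, hh2 R x q, - hh0 R x q]

theorem hh_cont (R : ℝ) : Continuous (fun z : (Fin 6 → ℝ) × Plane => hh0 R z.1 z.2) ∧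
    Continuous (fun z : (Fin 6 → ℝ) × Plane => hh1 R z.1 z.2) ∧
    Continuous (fun z : (Fin 6 → ℝ) × Plane => hh2 R z.1 z.2) := by
  unfold hh0 hh1 hh2 chordFn
  refine ⟨by fun_prop, by fun_prop, by fun_prop⟩

theorem wAB_cont (R : ℝ) (i : Fin 6) :
    Continuous (fun z : (Fin 6 → ℝ) × Plane => wA R z.1 z.2 i) ∧
    Continuous (fun z : (Fin 6 → ℝ) × Plane => wB R z.1 z.2 i) := by
  obtain ⟨h0, h1, h2⟩ := hh_cont R
  fin_cases i
  · exact ⟨h0, h1.neg⟩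
  · exact ⟨h1, h2.neg⟩
  · exact ⟨h2, h0⟩
  · exact ⟨h0.neg, h1⟩
  · exact ⟨h1.neg, h2⟩
  · exact ⟨h2.neg, h0.neg⟩

theorem w_boundary (R : ℝ) (x : Fin 6 → ℝ) (hx : x ∈ stdSimplex ℝ (Fin 6)) (q : Plane)
    (hq : ‖q‖ < R) (i : Fin 6) (hi : x i = 0) (ha : 0 < wA R x q i) (hb : 0 < wB R x q i) :
    False := by
  obtain ⟨hpos, hsum⟩ := hx
  rw [Fin.sum_univ_six] at hsum
  have p0 := hpos 0
  have p1 := hpos 1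
  have p2 := hpos 2
  have p3 := hpos 3
  have p4 := hpos 4
  have p5 := hpos 5
  set s1 := x 0 with hs1
  set s2 := x 0 + x 1 with hs2
  set s3 := x 0 + x 1 + x 2 with hs3
  set s4 := x 0 + x 1 + x 2 + x 3 with hs4
  set s5 := x 0 + x 1 + x 2 + x 3 + x 4 with hs5
  have e0 : hh0 R x q = chordFn R 0 s3 q := rfl
  have e1 : hh1 R x q = chordFn R s1 s4 q := rfl
  have e2 : hh2 R x q = chordFn R s2 s5 q := rfl
  have f0 : chordFn R s3 (0 + 1) q = - chordFn R 0 s3 q := chordFn_flip _ _ _ _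
  have f1 : chordFn R s4 (s1 + 1) q = - chordFn R s1 s4 q := chordFn_flip _ _ _ _
  have f2 : chordFn R s5 (s2 + 1) q = - chordFn R s2 s5 q := chordFn_flip _ _ _ _
  fin_cases i
  · change 0 < hh0 R x q at ha
    change 0 < - hh1 R x q at hb
    change x 0 = 0 at hi
    have : s1 = 0 := by linarith
    rw [e0] at ha; rw [e1, this] at hb
    exact chordFn_nest R 0 s3 s4 q hq (by linarith) (by linarith) (by linarith) ha (by linarith)
  · change 0 < hh1 R x q at ha
    change 0 < - hh2 R x q at hb
    change x 1 = 0 at hi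
    have : s2 = s1 := by linarith
    rw [e1] at ha; rw [e2, this] at hb
    exact chordFn_nest R s1 s4 s5 q hq (by linarith) (by linarith) (by linarith) ha (by linarith)
  · change 0 < hh2 R x q at ha
    change 0 < hh0 R x q at hb
    change x 2 = 0 at hi
    have : s2 = s3 := by linarith
    rw [e2, this] at ha; rw [e0] at hb
    exact chordFn_nest R s3 s5 (0 + 1) q hq (by linarith) (by linarith) (by linarith) ha
      (by linarith)
  · change 0 < - hh0 R x q at ha
    change 0 < hh1 R x q at hb
    change x 3 = 0 at hi
    have : s4 = s3 := by linarith
    rw [e0] at ha; rw [e1] at hb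
    rw [this] at f1 hb
    exact chordFn_nest R s3 (0 + 1) (s1 + 1) q hq (by linarith) (by linarith) (by linarith)
      (by linarith) (by linarith)
  · change 0 < - hh1 R x q at ha
    change 0 < hh2 R x q at hb
    change x 4 = 0 at hi
    have : s5 = s4 := by linarith
    rw [e1] at ha; rw [e2] at hb
    rw [this] at f2 hb
    exact chordFn_nest R s4 (s1 + 1) (s2 + 1) q hq (by linarith) (by linarith) (by linarith)
      (by linarith) (by linarith)
  · change 0 < - hh2 R x q at ha
    change 0 < - hh0 R x q at hb
    change x 5 = 0 at hi
    have : s5 = 0 + 1 := by linarith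
    have f3 := chordFn_shift R 0 s3 q
    rw [e2] at ha; rw [e0] at hb
    rw [this] at f2 ha
    exact chordFn_nest R (0 + 1) (s2 + 1) (s3 + 1) q hq (by linarith) (by linarith) (by linarith)
      (by linarith) (by linarith)

theorem hh_dep (R : ℝ) (x : Fin 6 → ℝ) (hx : x ∈ stdSimplex ℝ (Fin 6)) (hpos : ∀ i, 0 < x i)
    (q q' : Plane) (a0 : 0 < hh0 R x q) (a1 : hh1 R x q < 0) (a2 : 0 < hh2 R x q)
    (b0 : hh0 R x q' < 0) (b1 : 0 < hh1 R x q') (b2 : hh2 R x q' < 0) : False := by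
  obtain ⟨-, hsum⟩ := hx
  rw [Fin.sum_univ_six] at hsum
  have p0 := hpos 0
  have p1 := hpos 1
  have p2 := hpos 2
  have p3 := hpos 3
  have p4 := hpos 4
  have p5 := hpos 5
  have hpi := Real.pi_pos
  unfold hh0 chordFn at a0 b0
  unfold hh1 chordFn at a1 b1
  unfold hh2 chordFn at a2 b2
  set α0 := Real.pi * (0 + (x 0 + x 1 + x 2)) with hα0
  set α1 := Real.pi * (x 0 + (x 0 + x 1 + x 2 + x 3)) with hα1
  set α2 := Real.pi * (x 0 + x 1 + (x 0 + x 1 + x 2 + x 3 + x 4)) with hα2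
  have s1 : 0 < Real.sin (α2 - α1) := by
    have : α2 - α1 = Real.pi * (x 1 + x 4) := by rw [hα1, hα2]; ring
    rw [this]
    exact Real.sin_pos_of_pos_of_lt_pi (mul_pos hpi (by linarith)) (by nlinarith)
  have s2 : 0 < Real.sin (α1 - α0) := by
    have : α1 - α0 = Real.pi * (x 0 + x 3) := by rw [hα1, hα0]; ring
    rw [this]
    exact Real.sin_pos_of_pos_of_lt_pi (mul_pos hpi (by linarith)) (by nlinarith)
  have s3 : 0 < Real.sin (α2 - α0) := by
    have : α2 - α0 = Real.pi * (x 0 + x 1 + x 3 + x 4) := by rw [hα2, hα0]; ring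
    rw [this]
    exact Real.sin_pos_of_pos_of_lt_pi (mul_pos hpi (by linarith)) (by nlinarith)
  have ic : Real.sin (α2 - α1) * Real.cos α0 - Real.sin (α2 - α0) * Real.cos α1
      + Real.sin (α1 - α0) * Real.cos α2 = 0 := by
    simp only [Real.sin_sub]; ring
  have is : Real.sin (α2 - α1) * Real.sin α0 - Real.sin (α2 - α0) * Real.sin α1
      + Real.sin (α1 - α0) * Real.sin α2 = 0 := by
    simp only [Real.sin_sub]; ring
  have m1 := mul_pos s1 (sub_pos.mpr (b0.trans a0))
  have m2 := mul_pos s3 (sub_pos.mpr (a1.trans b1))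
  have m3 := mul_pos s2 (sub_pos.mpr (b2.trans a2))
  have key := add_pos (add_pos m1 m2) m3
  refine absurd key (not_lt.mpr (le_of_eq ?_))
  linear_combination (q 0 - q' 0) * ic + (q 1 - q' 1) * is

open scoped Classical in
theorem stmt_3 (F : Finset (Set Plane))
    (hne : ∀ S ∈ F, S.Nonempty)
    (hcpt : ∀ S ∈ F, IsCompact S)
    (hconv : ∀ S ∈ F, Convex ℝ S)
    (hT3 : ∀ A ∈ F, ∀ B ∈ F, ∀ C ∈ F, ∃ l : Set Plane, IsLine l ∧
      (A ∩ l).Nonempty ∧ (B ∩ l).Nonempty ∧ (C ∩ l).Nonempty) :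
    ∃ l : Set Plane, IsLine l ∧
      (F.card : ℝ) / 3 ≤ (F.filter (fun S => (S ∩ l).Nonempty)).card := by
  by_contra hno
  push Not at hno
  -- a disc containing everything
  obtain ⟨R, hR⟩ : ∃ R : ℝ, ∀ S ∈ F, ∀ q ∈ S, ‖q‖ < R := by
    have hc : IsCompact (⋃ S ∈ F, S) := F.isCompact_biUnion hcpt
    obtain ⟨R, hR⟩ := hc.isBounded.exists_norm_le
    refine ⟨R + 1, fun S hS q hq => ?_⟩
    have := hR q (Set.mem_biUnion hS hq)
    linarith
  obtain ⟨c0, c1, c2⟩ := hh_cont R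
  have cq : ∀ x, Continuous (hh0 R x) ∧ Continuous (hh1 R x) ∧ Continuous (hh2 R x) := fun x =>
    ⟨c0.comp (Continuous.prodMk_right x), c1.comp (Continuous.prodMk_right x),
      c2.comp (Continuous.prodMk_right x)⟩
  let A : Fin 6 → Set (Fin 6 → ℝ) := fun i =>
    {x | ∃ S ∈ F, ∀ q ∈ S, 0 < wA R x q i ∧ 0 < wB R x q i}
  have hA : ∀ i, IsOpen (A i) := by
    intro i
    rw [isOpen_iff_eventually]
    rintro x ⟨S, hS, hx⟩
    have := (hcpt S hS).eventually_forall_of_forall_eventually (x₀ := x)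
      (P := fun x q => 0 < wA R x q i ∧ 0 < wB R x q i) (fun q hq =>
        ((isOpen_lt continuous_const (wAB_cont R i).1).inter
          (isOpen_lt continuous_const (wAB_cont R i).2)).mem_nhds (hx q hq))
    exact this.mono (fun y hy => ⟨S, hS, hy⟩)
  have hbd : ∀ x ∈ stdSimplex ℝ (Fin 6), ∀ i, x i = 0 → x ∉ A i := by
    rintro x hx i hi ⟨S, hS, h⟩
    obtain ⟨q, hq⟩ := hne S hS
    exact w_boundary R x hx q (hR S hS q hq) i hi (h q hq).1 (h q hq).2
  have hcov : ∀ x ∈ stdSimplex ℝ (Fin 6), ∃ i, x ∈ A i := by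
    intro x _
    have l0 := hno {q | hh0 R x q = 0} (chordFn_line _ _ _)
    have l1 := hno {q | hh1 R x q = 0} (chordFn_line _ _ _)
    have l2 := hno {q | hh2 R x q = 0} (chordFn_line _ _ _)
    obtain ⟨S, hS, n0, n1, n2⟩ : ∃ S ∈ F, ¬ (S ∩ {q | hh0 R x q = 0}).Nonempty ∧
        ¬ (S ∩ {q | hh1 R x q = 0}).Nonempty ∧ ¬ (S ∩ {q | hh2 R x q = 0}).Nonempty := by
      by_contra hcon
      push Not at hcon
      have hsub : F ⊆ (F.filter (fun S => (S ∩ {q | hh0 R x q = 0}).Nonempty) ∪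
          F.filter (fun S => (S ∩ {q | hh1 R x q = 0}).Nonempty)) ∪
          F.filter (fun S => (S ∩ {q | hh2 R x q = 0}).Nonempty) := by
        intro S hS
        simp only [Finset.mem_union, Finset.mem_filter, hS, true_and]
        by_cases g0 : (S ∩ {q | hh0 R x q = 0}).Nonempty
        · exact Or.inl (Or.inl g0)
        by_cases g1 : (S ∩ {q | hh1 R x q = 0}).Nonempty
        · exact Or.inl (Or.inr g1)
        · refine Or.inr ?_
          by_contra g2
          rw [Set.not_nonempty_iff_eq_empty] at g0 g1
          have := hcon S hS g0 g1
          exact g2 this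
      have h1 := (Finset.card_le_card hsub).trans ((Finset.card_union_le _ _).trans
        (Nat.add_le_add_right (Finset.card_union_le _ _) _))
      have h2 : (F.card : ℝ) ≤
          ((F.filter (fun S => (S ∩ {q | hh0 R x q = 0}).Nonempty)).card : ℝ) +
          (F.filter (fun S => (S ∩ {q | hh1 R x q = 0}).Nonempty)).card +
          (F.filter (fun S => (S ∩ {q | hh2 R x q = 0}).Nonempty)).card := by
        exact_mod_cast h1
      linarith
    have k0 := const_sign _ (cq x).1 S (hconv S hS) (fun q hq h => n0 ⟨q, hq, h⟩)
    have k1 := const_sign _ (cq x).2.1 S (hconv S hS) (fun q hq h => n1 ⟨q, hq, h⟩)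
    have k2 := const_sign _ (cq x).2.2 S (hconv S hS) (fun q hq h => n2 ⟨q, hq, h⟩)
    rcases k0 with k0 | k0
    · rcases k1 with k1 | k1
      · rcases k2 with k2 | k2
        · exact ⟨2, S, hS, fun q hq => ⟨k2 q hq, k0 q hq⟩⟩
        · exact ⟨1, S, hS, fun q hq => ⟨k1 q hq, neg_pos.mpr (k2 q hq)⟩⟩
      · exact ⟨0, S, hS, fun q hq => ⟨k0 q hq, neg_pos.mpr (k1 q hq)⟩⟩
    · rcases k1 with k1 | k1
      · exact ⟨3, S, hS, fun q hq => ⟨neg_pos.mpr (k0 q hq), k1 q hq⟩⟩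
      · rcases k2 with k2 | k2
        · exact ⟨4, S, hS, fun q hq => ⟨neg_pos.mpr (k1 q hq), k2 q hq⟩⟩
        · exact ⟨5, S, hS, fun q hq => ⟨neg_pos.mpr (k2 q hq), neg_pos.mpr (k0 q hq)⟩⟩
  obtain ⟨x, hx, hall⟩ := kkm_six A hA hcov hbd
  have hpos : ∀ i, 0 < x i := fun i =>
    lt_of_le_of_ne (hx.1 i) (fun h => hbd x hx i h.symm (hall i))
  have dep := hh_dep R x hx hpos
  by_cases hcase : ∃ q', hh0 R x q' < 0 ∧ 0 < hh1 R x q' ∧ hh2 R x q' < 0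
  · obtain ⟨q', b0, b1, b2⟩ := hcase
    obtain ⟨S, hS, hSw⟩ := hall 0
    obtain ⟨T, hT, hTw⟩ := hall 2
    obtain ⟨U, hU, hUw⟩ := hall 4
    obtain ⟨l, hl, ⟨p, hp, hpl⟩, ⟨q, hq, hql⟩, ⟨r, hr, hrl⟩⟩ := hT3 S hS T hT U hU
    have P : 0 < hh0 R x p ∧ 0 < - hh1 R x p := hSw p hp
    have Q : 0 < hh2 R x q ∧ 0 < hh0 R x q := hTw q hq
    have V : 0 < - hh1 R x r ∧ 0 < hh2 R x r := hUw r hr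
    have P2 : ¬ 0 < hh2 R x p := fun h => dep p q' P.1 (neg_pos.mp P.2) h b0 b1 b2
    have Q2 : ¬ hh1 R x q < 0 := fun h => dep q q' Q.2 h Q.1 b0 b1 b2
    have V2 : ¬ 0 < hh0 R x r := fun h => dep r q' h (neg_pos.mp V.1) V.2 b0 b1 b2
    rcases line3 l hl p q r hpl hql hrl with h | h | h
    · exact P2 (seg_pos _ _ _ _ _ _ h Q.1 V.2)
    · exact Q2 (seg_neg _ _ _ _ _ _ h (neg_pos.mp P.2) (neg_pos.mp V.1))
    · exact V2 (seg_pos _ _ _ _ _ _ h P.1 Q.2)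
  · push Not at hcase
    obtain ⟨S, hS, hSw⟩ := hall 1
    obtain ⟨T, hT, hTw⟩ := hall 3
    obtain ⟨U, hU, hUw⟩ := hall 5
    obtain ⟨l, hl, ⟨p, hp, hpl⟩, ⟨q, hq, hql⟩, ⟨r, hr, hrl⟩⟩ := hT3 S hS T hT U hU
    have P : 0 < hh1 R x p ∧ 0 < - hh2 R x p := hSw p hp
    have Q : 0 < - hh0 R x q ∧ 0 < hh1 R x q := hTw q hq
    have V : 0 < - hh2 R x r ∧ 0 < - hh0 R x r := hUw r hr
    have P2 : ¬ hh0 R x p < 0 := fun h => not_lt.mpr (hcase p h P.1) (neg_pos.mp P.2)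
    have Q2 : ¬ hh2 R x q < 0 := fun h => not_lt.mpr (hcase q (neg_pos.mp Q.1) Q.2) h
    have V2 : ¬ 0 < hh1 R x r := fun h =>
      not_lt.mpr (hcase r (neg_pos.mp V.2) h) (neg_pos.mp V.1)
    rcases line3 l hl p q r hpl hql hrl with h | h | h
    · exact P2 (seg_neg _ _ _ _ _ _ h (neg_pos.mp Q.1) (neg_pos.mp V.2))
    · exact Q2 (seg_neg _ _ _ _ _ _ h (neg_pos.mp P.2) (neg_pos.mp V.1))
    · exact V2 (seg_pos _ _ _ _ _ _ h P.1 Q.2)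
end

section
/- Let F be a finite family of nonempty compact connected sets in ℝ² such that every three members of F form a tight triple. Then there exists a line in ℝ² that intersects at least |F|/3 of the members of F. -/
open Set

namespace Sp

/-- Displacement vectors of the cyclic triangulation. -/
def dsp (j : Fin 6) : Fin 6 → ℤ := Pi.single (j + 1) 1 - Pi.single j 1

/-- cells -/
def IsCell (N : ℤ) (s : (Fin 6 → Fin 6 → ℤ) × Equiv.Perm (Fin 6)) : Prop :=
  (∀ i, s.1 (i + 1) - s.1 i = dsp (s.2 i)) ∧ (∀ i j, 0 ≤ s.1 i j) ∧ ∀ i, ∑ j, s.1 i j = N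

def piv (i : Fin 6) (s : (Fin 6 → Fin 6 → ℤ) × Equiv.Perm (Fin 6)) :
    (Fin 6 → Fin 6 → ℤ) × Equiv.Perm (Fin 6) :=
  (Function.update s.1 i (s.1 (i - 1) + s.1 (i + 1) - s.1 i), s.2 * Equiv.swap (i - 1) i)

lemma f1 (i : Fin 6) : i - 1 ≠ i := by revert i; decide
lemma f2 (i : Fin 6) : i + 1 ≠ i := by revert i; decide
lemma f3 (i : Fin 6) : i - 1 ≠ i + 1 := by revert i; decide
lemma f4 (i : Fin 6) : i - 1 + 1 = i := by revert i; decide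

lemma piv_step (i : Fin 6) (s : (Fin 6 → Fin 6 → ℤ) × Equiv.Perm (Fin 6))
    (h : ∀ i, s.1 (i + 1) - s.1 i = dsp (s.2 i)) :
    ∀ k, (piv i s).1 (k + 1) - (piv i s).1 k = dsp ((piv i s).2 k) := by
  intro k
  have h1 := h (i - 1)
  rw [f4] at h1
  by_cases hk : k = i
  · subst hk
    simp only [piv, Function.update_self, Function.update_of_ne (f2 k), Equiv.Perm.mul_apply,
      Equiv.swap_apply_right]
    rw [← h1]; abel
  · by_cases hk' : k = i - 1
    · subst hk'
      rw [f4]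
      simp only [piv, Function.update_self, Function.update_of_ne (f1 i), Equiv.Perm.mul_apply,
        Equiv.swap_apply_left]
      rw [← h i]; abel
    · have : k + 1 ≠ i := by
        rintro rfl; apply hk'; simp
      simp only [piv, Function.update_of_ne this, Function.update_of_ne hk, Equiv.Perm.mul_apply,
        Equiv.swap_apply_of_ne_of_ne hk' hk]
      exact h k

lemma piv_piv (i : Fin 6) (s : (Fin 6 → Fin 6 → ℤ) × Equiv.Perm (Fin 6)) :
    piv i (piv i s) = s := by
  refine Prod.ext ?_ ?_
  · simp only [piv, Function.update_self, Function.update_of_ne (f2 i), Function.update_of_ne (f1 i),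
      Function.update_idem]
    rw [show s.1 (i - 1) + s.1 (i + 1) - (s.1 (i - 1) + s.1 (i + 1) - s.1 i) = s.1 i by abel]
    simp
  · simp [piv, mul_assoc]

lemma piv_sign (i : Fin 6) (s : (Fin 6 → Fin 6 → ℤ) × Equiv.Perm (Fin 6)) :
    (((piv i s).2.sign : ℤˣ) : ℤ) = - ((s.2.sign : ℤˣ) : ℤ) := by
  simp [piv, Equiv.Perm.sign_swap (f1 i)]

lemma piv_sum (N : ℤ) (i : Fin 6) (s : (Fin 6 → Fin 6 → ℤ) × Equiv.Perm (Fin 6))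
    (h : ∀ i, ∑ j, s.1 i j = N) : ∀ i', ∑ j, (piv i s).1 i' j = N := by
  intro k
  by_cases hk : k = i
  · subst hk
    simp [piv, Finset.sum_add_distrib, h]
  · simp [piv, Function.update_of_ne hk, h]

lemma dsp_le (a j : Fin 6) : dsp a j ≤ 1 := by
  revert a j; decide
lemma dsp_ge (a j : Fin 6) : -1 ≤ dsp a j := by
  revert a j; decide
lemma dsp_pos (a j : Fin 6) (h : 0 < dsp a j) : a + 1 = j := by
  revert a j; decide
lemma dsp_neg (a j : Fin 6) (h : dsp a j < 0) : a = j := by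
  revert a j; decide
lemma dsp_zero (a j : Fin 6) (h : a + 1 ≠ j) (h' : a ≠ j) : dsp a j = 0 := by
  revert a j; decide

lemma piv_out (N : ℤ) (i : Fin 6) (s : (Fin 6 → Fin 6 → ℤ) × Equiv.Perm (Fin 6))
    (h : IsCell N s) (hp : ¬ IsCell N (piv i s)) :
    ∃ j, ∀ k, k ≠ i → s.1 k j = 0 := by
  obtain ⟨hs, h0, hN⟩ := h
  have h1 : ¬ ∀ a j, 0 ≤ (piv i s).1 a j := fun hh => hp ⟨piv_step i s hs, hh, piv_sum N i s hN⟩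
  push Not at h1
  obtain ⟨a, j, haj⟩ := h1
  have ha : a = i := by
    by_contra hne
    simp only [piv, Function.update_of_ne hne] at haj
    exact absurd (h0 a j) (by omega)
  subst ha
  simp only [piv, Function.update_self, Pi.sub_apply, Pi.add_apply] at haj
  have e1 := congrFun (hs (a - 1)) j
  have e2 := congrFun (hs a) j
  rw [f4] at e1
  simp only [Pi.sub_apply] at e1 e2
  have b1 := dsp_le (s.2 (a - 1)) j
  have b2 := dsp_ge (s.2 a) j
  have c1 := h0 (a - 1) j
  have c2 := h0 (a + 1) j
  have d1 := dsp_pos (s.2 (a - 1)) j (by omega)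
  have d2 := dsp_neg (s.2 a) j (by omega)
  have hz : ∀ k, k ≠ a - 1 → k ≠ a → s.1 (k + 1) j = s.1 k j := by
    intro k hk hk'
    have := congrFun (hs k) j
    rw [dsp_zero (s.2 k) j] at this
    · simp only [Pi.sub_apply] at this; omega
    · intro hh; apply hk; apply s.2.injective
      exact add_right_cancel (hh.trans d1.symm)
    · intro hh; apply hk'; apply s.2.injective
      exact hh.trans d2.symm
  refine ⟨j, ?_⟩
  have c3 : s.1 (a + 1) j = 0 := by omega
  have key : ∀ (f : Fin 6 → ℤ), (∀ k, k ≠ a - 1 → k ≠ a → f (k + 1) = f k) → f (a + 1) = 0 →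
      ∀ k, k ≠ a → f k = 0 := by
    intro f hf h0
    have g1 := hf (a + 1) (by clear * -; revert a; decide) (by clear * -; revert a; decide)
    have g2 := hf (a + 1 + 1) (by clear * -; revert a; decide) (by clear * -; revert a; decide)
    have g3 := hf (a + 1 + 1 + 1) (by clear * -; revert a; decide) (by clear * -; revert a; decide)
    have g4 := hf (a + 1 + 1 + 1 + 1) (by clear * -; revert a; decide) (by clear * -; revert a; decide)
    intro k hk
    have : k = a + 1 ∨ k = a + 1 + 1 ∨ k = a + 1 + 1 + 1 ∨ k = a + 1 + 1 + 1 + 1 ∨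
      k = a + 1 + 1 + 1 + 1 + 1 := by
      clear * - hk; revert a k; decide
    rcases this with rfl | rfl | rfl | rfl | rfl <;> omega
  exact key (fun k => s.1 k j) hz c3

lemma det_cone (N : ℤ) (hN : N ≠ 0) (M : Matrix (Fin 6) (Fin 6) ℤ) (u : Fin 6 → ℤ)
    (hM : ∀ i, ∑ j, M i j = N) (hu : ∑ j, u j = N) :
    M.det = ∑ i, (M.updateRow i u).det := by
  have h := Matrix.mulVec_cramer M.transpose u
  have h2 := congrArg (fun w : Fin 6 → ℤ => ∑ j, w j) h
  simp only [Matrix.mulVec, dotProduct, Pi.smul_apply, smul_eq_mul, Matrix.det_transpose,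
    ← Finset.mul_sum, hu, Matrix.transpose_apply] at h2
  rw [Finset.sum_comm] at h2
  simp only [← Finset.sum_mul, hM, Matrix.cramer_transpose_apply, ← Finset.mul_sum] at h2
  apply mul_right_cancel₀ hN
  rw [← h2, mul_comm]

lemma cells_finite (N : ℤ) : {s | IsCell N s}.Finite := by
  apply Set.Finite.subset (Set.Finite.prod (s := Set.Icc (0 : Fin 6 → Fin 6 → ℤ) (fun _ _ => N))
    (t := (Set.univ : Set (Equiv.Perm (Fin 6)))) (Set.finite_Icc _ _) Set.finite_univ)
  rintro ⟨v, σ⟩ ⟨h1, h2, h3⟩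
  refine ⟨⟨fun i j => h2 i j, fun i j => ?_⟩, trivial⟩
  rw [← h3 i]
  exact Finset.single_le_sum (f := fun j => v i j) (fun j _ => h2 i j) (Finset.mem_univ j)

noncomputable def cells (N : ℤ) := (cells_finite N).toFinset

lemma mem_cells (N : ℤ) (s) : s ∈ cells N ↔ IsCell N s := by simp [cells]

/-- weighted total -/
noncomputable def tot (N : ℤ) (φ : (Fin 6 → ℤ) → Fin 6 → ℤ) : ℤ :=
  ∑ s ∈ cells N, ((s.2.sign : ℤˣ) : ℤ) * (Matrix.of fun i => φ (s.1 i)).det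

/-- face preserving maps -/
def Good (N : ℤ) (φ : (Fin 6 → ℤ) → Fin 6 → ℤ) : Prop :=
  ∀ x, (∀ j, 0 ≤ x j) → ∑ j, x j = N → (∑ j, φ x j = N ∧ ∀ j, x j = 0 → φ x j = 0)

lemma tot_update (N : ℤ) (hN : N ≠ 0) (φ φ' : (Fin 6 → ℤ) → Fin 6 → ℤ) (hφ : Good N φ)
    (hφ' : Good N φ') (w : Fin 6 → ℤ) (hw0 : ∀ j, 0 ≤ w j) (hwN : ∑ j, w j = N)
    (hd : ∀ x, x ≠ w → φ x = φ' x) : tot N φ = tot N φ' := by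
  classical
  set u := φ w with hu
  have cone : ∀ ψ, Good N ψ → tot N ψ = ∑ a ∈ cells N ×ˢ (Finset.univ : Finset (Fin 6)),
      ((a.1.2.sign : ℤˣ) : ℤ) * ((Matrix.of fun i => ψ (a.1.1 i)).updateRow a.2 u).det := by
    intro ψ hψ
    rw [Finset.sum_product, tot]
    refine Finset.sum_congr rfl fun s hs => ?_
    rw [mem_cells] at hs
    dsimp only
    rw [← Finset.mul_sum, ← det_cone N hN _ u _ (hφ w hw0 hwN).1]
    intro i
    exact (hψ (s.1 i) (hs.2.1 i) (hs.2.2 i)).1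
  have bdry : ∀ s i, IsCell N s → ¬ IsCell N (piv i s) →
      ((Matrix.of fun k => φ (s.1 k)).updateRow i u).det =
          ((Matrix.of fun k => φ' (s.1 k)).updateRow i u).det := by
        intro s i ha hp
        obtain ⟨j, hj⟩ := piv_out N i s ha hp
        by_cases hex : ∃ k, k ≠ i ∧ s.1 k = w
        · obtain ⟨k, hk, hkw⟩ := hex
          have huj : u j = 0 := (hφ w hw0 hwN).2 j (by rw [← hkw]; exact hj k hk)
          have : ∀ ψ : (Fin 6 → ℤ) → Fin 6 → ℤ, Good N ψ →
              ((Matrix.of fun k => ψ (s.1 k)).updateRow i u).det = 0 := by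
            intro ψ hψ
            apply Matrix.det_eq_zero_of_column_eq_zero j
            intro l
            by_cases hl : l = i
            · subst hl; simpa using huj
            · simp only [Matrix.updateRow_ne hl, Matrix.of_apply]
              exact (hψ _ (ha.2.1 l) (ha.2.2 l)).2 j (hj l hl)
          rw [this φ hφ, this φ' hφ']
        · push Not at hex
          congr 1
          ext k l
          by_cases hk : k = i
          · subst hk; simp
          · simp [Matrix.updateRow_ne hk, hd _ (hex k hk)]
  rw [cone φ hφ, cone φ' hφ', ← sub_eq_zero, ← Finset.sum_sub_distrib]
  refine Finset.sum_involution
    (fun a _ => if IsCell N (piv a.2 a.1) then (piv a.2 a.1, a.2) else a) ?_ ?_ ?_ ?_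
  · rintro ⟨s, i⟩ ha
    simp only [Finset.mem_product, Finset.mem_univ, and_true, mem_cells] at ha
    by_cases hp : IsCell N (piv i s)
    · simp only [hp, if_true, piv_sign]
      have : ∀ ψ : (Fin 6 → ℤ) → Fin 6 → ℤ, (Matrix.of fun k => ψ ((piv i s).1 k)).updateRow i u =
          (Matrix.of fun k => ψ (s.1 k)).updateRow i u := by
        intro ψ
        ext k l
        by_cases hk : k = i
        · subst hk; simp
        · simp [Matrix.updateRow_ne hk, piv, Function.update_of_ne hk]
      rw [this φ, this φ']; ring
    · simp only [hp, if_false]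
      have := bdry s i ha hp
      rw [this]; ring
  · rintro ⟨s, i⟩ ha hne
    simp only [Finset.mem_product, Finset.mem_univ, and_true, mem_cells] at ha
    by_cases hp : IsCell N (piv i s)
    · simp only [hp, if_true]
      intro heq
      have h1 := piv_sign i s
      have h2 : piv i s = s := (Prod.ext_iff.1 heq).1
      rw [h2] at h1
      rcases Int.units_eq_one_or (Equiv.Perm.sign s.2) with h | h <;> simp [h] at h1
    · exfalso; apply hne
      have := bdry s i ha hp
      rw [this]; ring
  · rintro ⟨s, i⟩ ha
    simp only [Finset.mem_product, Finset.mem_univ, and_true, mem_cells] at ha ⊢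
    by_cases hp : IsCell N (piv i s) <;> simp [hp, ha]
  · rintro ⟨s, i⟩ ha
    simp only [Finset.mem_product, Finset.mem_univ, and_true, mem_cells] at ha
    by_cases hp : IsCell N (piv i s)
    · simp [hp, piv_piv, ha]
    · simp [hp]

lemma piv_det (i : Fin 6) (s : (Fin 6 → Fin 6 → ℤ) × Equiv.Perm (Fin 6)) :
    (Matrix.of (piv i s).1).det = - (Matrix.of s.1).det := by
  have h : Matrix.of (piv i s).1 =
      (Matrix.of s.1).updateRow i ((s.1 (i - 1) + s.1 (i + 1)) + (-1 : ℤ) • s.1 i) := by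
    ext k l
    by_cases hk : k = i
    · subst hk; simp [piv]; ring
    · simp [piv, Function.update_of_ne hk, Matrix.updateRow_ne hk]
  rw [h, Matrix.det_updateRow_add, Matrix.det_updateRow_add, Matrix.det_updateRow_smul]
  have h1 : ((Matrix.of s.1).updateRow i (s.1 (i - 1))).det = 0 := by
    apply Matrix.det_zero_of_row_eq (f1 i)
    rw [Matrix.updateRow_ne (f1 i), Matrix.updateRow_self]; rfl
  have h2 : ((Matrix.of s.1).updateRow i (s.1 (i + 1))).det = 0 := by
    apply Matrix.det_zero_of_row_eq (f2 i)
    rw [Matrix.updateRow_ne (f2 i), Matrix.updateRow_self]; rfl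
  have h3 : (Matrix.of s.1).updateRow i (s.1 i) = Matrix.of s.1 :=
    Matrix.updateRow_eq_self (Matrix.of s.1) i
  rw [h1, h2, h3]; ring

lemma base_det (N : ℤ) (v : Fin 6 → Fin 6 → ℤ) (h : ∀ i, v (i + 1) - v i = dsp i)
    (hN : ∑ j, v 0 j = N) : (Matrix.of v).det = N := by
  have hv : ∀ k, v k = v 0 + (Pi.single k 1 - Pi.single 0 1) := by
    have e : ∀ k, v (k + 1) = v k + (Pi.single (k + 1) 1 - Pi.single k 1) := by
      intro k; have := h k; rw [dsp] at this; rw [← this]; abel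
    have e0 := e 0
    have e1 := e 1
    have e2 := e 2
    have e3 := e 3
    have e4 := e 4
    simp only [Fin.isValue, zero_add, Fin.reduceAdd] at e0 e1 e2 e3 e4
    rw [e0] at e1; rw [e1] at e2; rw [e2] at e3; rw [e3] at e4
    intro k
    fin_cases k
    · simp
    · exact e0
    · refine e1.trans ?_; simp; abel
    · refine e2.trans ?_; simp; abel
    · refine e3.trans ?_; simp; abel
    · refine e4.trans ?_; simp; abel
  have : Matrix.of v = 1 + Matrix.replicateCol Unit (fun _ => (1 : ℤ)) *
      Matrix.replicateRow Unit (v 0 - Pi.single 0 1) := by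
    ext k l
    simp [hv k, Matrix.mul_apply, Matrix.one_apply, Pi.single_apply, eq_comm]
    ring
  rw [this, Matrix.det_one_add_replicateCol_mul_replicateRow]
  simp [dotProduct, hN]

lemma cell_det (N : ℤ) (σ : Equiv.Perm (Fin 6)) : ∀ v : Fin 6 → Fin 6 → ℤ,
    (∀ i, v (i + 1) - v i = dsp (σ i)) → (∀ i, ∑ j, v i j = N) →
      ((σ.sign : ℤˣ) : ℤ) * (Matrix.of v).det = N := by
  have hσ : σ ∈ Submonoid.closure (Set.range fun i : Fin 5 => Equiv.swap i.castSucc i.succ) := by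
    rw [Equiv.Perm.mclosure_swap_castSucc_succ]; trivial
  induction hσ using Submonoid.closure_induction_right with
  | one =>
    intro v h1 h2
    simpa using base_det N v h1 (h2 0)
  | mul_right σ _ τ hτ ih =>
    obtain ⟨i, rfl⟩ := hτ
    have hi : i.castSucc = i.succ - 1 := by revert i; decide
    intro v h1 h2
    have := ih (piv i.succ (v, σ * Equiv.swap i.castSucc i.succ)).1 ?_
      (piv_sum N _ (v, σ * Equiv.swap i.castSucc i.succ) h2)
    · rw [piv_det] at this
      rw [← this]
      rw [Equiv.Perm.sign_mul, Equiv.Perm.sign_swap (by rw [hi]; exact f1 _)]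
      simp
    · have := piv_step i.succ (v, σ * Equiv.swap i.castSucc i.succ) h1
      simpa [piv, ← hi, mul_assoc] using this

lemma cells_nonempty (N : ℤ) (hN : 0 < N) : (cells N).Nonempty := by
  refine ⟨(fun k => Pi.single k 1 + Pi.single 0 (N - 1), 1), ?_⟩
  rw [mem_cells]
  refine ⟨fun i => ?_, fun i j => ?_, fun i => ?_⟩
  · simp [dsp]
  · simp only [Pi.add_apply, Pi.single_apply]
    split_ifs <;> omega
  · simp [Finset.sum_add_distrib]

lemma tot_id (N : ℤ) (hN : 0 < N) : tot N id ≠ 0 := by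
  have : tot N id = ∑ s ∈ cells N, N := by
    refine Finset.sum_congr rfl fun s hs => ?_
    rw [mem_cells] at hs
    exact cell_det N s.2 s.1 hs.1 hs.2.2
  rw [this, Finset.sum_const, nsmul_eq_mul]
  have := Finset.card_pos.2 (cells_nonempty N hN)
  positivity

lemma tot_eq (N : ℤ) (hN : 0 < N) (φ : (Fin 6 → ℤ) → Fin 6 → ℤ) (hφ : Good N φ) :
    tot N φ ≠ 0 := by
  classical
  have hid : Good N id := fun x _ h2 => ⟨h2, fun j hj => hj⟩
  have hgood : ∀ W : Finset (Fin 6 → ℤ), Good N (fun x => if x ∈ W then φ x else x) := by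
    intro W x h1 h2
    dsimp only
    split_ifs
    · exact hφ x h1 h2
    · exact hid x h1 h2
  have key : ∀ W : Finset (Fin 6 → ℤ), (∀ w ∈ W, (∀ j, 0 ≤ w j) ∧ ∑ j, w j = N) →
      tot N (fun x => if x ∈ W then φ x else x) = tot N id := by
    intro W
    induction W using Finset.induction_on with
    | empty => intro _; simp; rfl
    | insert w W hw ih =>
      intro h
      rw [← ih (fun x hx => h x (Finset.mem_insert_of_mem hx))]
      have hw' := h w (Finset.mem_insert_self _ _)
      apply tot_update N hN.ne' _ _ (hgood _) (hgood _) w hw'.1 hw'.2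
      intro x hx
      simp [hx]
  have := key ((cells N).biUnion fun s => Finset.univ.image s.1) ?_
  · rw [show tot N φ = tot N id from ?_]
    · exact tot_id N hN
    · rw [← this]
      refine Finset.sum_congr rfl fun s hs => ?_
      congr 3
      ext i : 1
      dsimp only
      rw [if_pos]
      rw [Finset.mem_biUnion]
      exact ⟨s, hs, Finset.mem_image_of_mem _ (Finset.mem_univ _)⟩
  · intro w hw
    simp only [Finset.mem_biUnion, Finset.mem_image, Finset.mem_univ, true_and] at hw
    obtain ⟨s, hs, i, rfl⟩ := hw
    rw [mem_cells] at hs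
    exact ⟨hs.2.1 i, hs.2.2 i⟩

lemma sperner (N : ℤ) (hN : 0 < N) (lab : (Fin 6 → ℤ) → Fin 6)
    (hlab : ∀ x : Fin 6 → ℤ, (∀ j, 0 ≤ x j) → ∑ j, x j = N → x (lab x) ≠ 0) :
    ∃ s, IsCell N s ∧ ∀ j, ∃ i, lab (s.1 i) = j := by
  have h := tot_eq N hN (fun x => Pi.single (lab x) N) ?_
  · obtain ⟨s, hs, hne⟩ := Finset.exists_ne_zero_of_sum_ne_zero h
    rw [mem_cells] at hs
    refine ⟨s, hs, ?_⟩
    have hinj : Function.Injective fun i => lab (s.1 i) := by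
      intro a b hab
      by_contra hne'
      apply hne
      rw [Matrix.det_zero_of_row_eq hne', mul_zero]
      simp only [] at hab
      ext l
      simp [hab]
    exact Finite.surjective_of_injective hinj
  · intro x h1 h2
    refine ⟨by simp, fun j hj => ?_⟩
    dsimp only
    rw [Pi.single_apply, if_neg]
    rintro rfl
    exact hlab x h1 h2 hj

lemma cell_close (N : ℤ) (s) (h : IsCell N s) (i j : Fin 6) : |s.1 0 j - s.1 i j| ≤ 5 := by
  have e : ∀ k, |s.1 (k + 1) j - s.1 k j| ≤ 1 := by
    intro k
    have := congrFun (h.1 k) j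
    rw [Pi.sub_apply] at this
    rw [this, abs_le]
    exact ⟨dsp_ge _ _, dsp_le _ _⟩
  have e0 := abs_le.1 (e 0)
  have e1 := abs_le.1 (e 1)
  have e2 := abs_le.1 (e 2)
  have e3 := abs_le.1 (e 3)
  have e4 := abs_le.1 (e 4)
  simp only [Fin.isValue, zero_add, Fin.reduceAdd] at e0 e1 e2 e3 e4
  rw [abs_le]
  fin_cases i <;> simp only [Fin.zero_eta, Fin.mk_one, Fin.reduceFinMk, Fin.isValue] <;> omega

/-- open KKM -/
lemma kkm (A : Fin 6 → Set (Fin 6 → ℝ)) (hA : ∀ i, IsOpen (A i))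
    (hc : stdSimplex ℝ (Fin 6) ⊆ ⋃ i, A i)
    (h0 : ∀ i, ∀ x ∈ stdSimplex ℝ (Fin 6), x i = 0 → x ∉ A i) :
    ∃ x ∈ stdSimplex ℝ (Fin 6), ∀ i, x ∈ A i := by
  obtain ⟨δ, hδ, hl⟩ := lebesgue_number_lemma_of_metric (isCompact_stdSimplex ℝ (Fin 6)) hA hc
  obtain ⟨N, hN⟩ := exists_nat_gt (5 / δ)
  have hNp : (0 : ℝ) < N := lt_trans (by positivity) hN
  have hNp' : (0 : ℤ) < N := by exact_mod_cast hNp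
  set sc : (Fin 6 → ℤ) → Fin 6 → ℝ := fun x j => (x j : ℝ) / N with hsc
  have hmem : ∀ x : Fin 6 → ℤ, (∀ j, 0 ≤ x j) → ∑ j, x j = N → sc x ∈ stdSimplex ℝ (Fin 6) := by
    intro x h1 h2
    refine ⟨fun j => ?_, ?_⟩
    · have : (0 : ℝ) ≤ x j := by exact_mod_cast h1 j
      simp only [hsc]; positivity
    · simp only [hsc]
      rw [← Finset.sum_div, div_eq_one_iff_eq hNp.ne']
      exact_mod_cast h2
  have hl' : ∀ x : Fin 6 → ℤ, ∃ i, (∀ j, 0 ≤ x j) → ∑ j, x j = N →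
      Metric.ball (sc x) δ ⊆ A i := by
    intro x
    by_cases h : (∀ j, 0 ≤ x j) ∧ ∑ j, x j = N
    · obtain ⟨i, hi⟩ := hl _ (hmem x h.1 h.2)
      exact ⟨i, fun _ _ => hi⟩
    · exact ⟨0, fun h1 h2 => absurd ⟨h1, h2⟩ h⟩
  choose lab hlab using hl'
  have hl2 : ∀ x : Fin 6 → ℤ, (∀ j, 0 ≤ x j) → ∑ j, x j = N → x (lab x) ≠ 0 := by
    intro x h1 h2 hz
    refine h0 (lab x) (sc x) (hmem x h1 h2) (by simp [hsc, hz]) ?_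
    exact hlab x h1 h2 (Metric.mem_ball_self hδ)
  obtain ⟨s, hs, hsur⟩ := sperner N hNp' lab hl2
  · refine ⟨sc (s.1 0), hmem _ (hs.2.1 0) (hs.2.2 0), fun i => ?_⟩
    obtain ⟨k, rfl⟩ := hsur i
    apply hlab _ (hs.2.1 k) (hs.2.2 k)
    rw [Metric.mem_ball, dist_pi_lt_iff hδ]
    intro j
    have hcl := cell_close N s hs k j
    rw [Real.dist_eq]
    simp only [hsc]
    rw [← sub_div, abs_div, abs_of_pos hNp, div_lt_iff₀ hNp]
    have : |((s.1 0 j : ℝ) - s.1 k j)| ≤ 5 := by exact_mod_cast hcl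
    have h5 : 5 < δ * N := by rw [div_lt_iff₀ hδ] at hN; linarith
    linarith

end Sp

namespace Geo

/-- side function of the chord of the circle of radius `R` with end angles `a`, `b`. -/
noncomputable def cs (R a b : ℝ) (p : Plane) : ℝ :=
  p 0 * Real.cos ((a + b) / 2) + p 1 * Real.sin ((a + b) / 2) - R * Real.cos ((b - a) / 2)

lemma isLine_cs (R a b : ℝ) : IsLine {p | cs R a b p = 0} := by
  set m := (a + b) / 2 with hm
  set c := R * Real.cos ((b - a) / 2) with hc
  have h1 := Real.sin_sq_add_cos_sq m
  refine ⟨!₂[c * Real.cos m, c * Real.sin m], !₂[-Real.sin m, Real.cos m], ?_, ?_⟩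
  · intro h
    have e0 := congrArg (fun q : Plane => q 0) h
    have e1 := congrArg (fun q : Plane => q 1) h
    simp at e0 e1
    rw [e0, e1] at h1; norm_num at h1
  · ext p
    simp only [mem_ofPred_eq, cs, ← hm, ← hc]
    constructor
    · intro h
      refine ⟨-p 0 * Real.sin m + p 1 * Real.cos m, ?_⟩
      ext i
      fin_cases i
      · simp; linear_combination Real.cos m * h - p 0 * h1
      · simp; linear_combination Real.sin m * h - p 1 * h1
    · rintro ⟨t, rfl⟩
      simp; linear_combination c * h1

lemma wedge (R t a b : ℝ) (p : Plane) (hR : 0 < R) (hp : p 0 ^ 2 + p 1 ^ 2 < R ^ 2)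
    (ha : 0 ≤ a) (hab : a ≤ b) (hb : b ≤ Real.pi)
    (h1 : R * Real.cos a < p 0 * Real.cos (t + a) + p 1 * Real.sin (t + a))
    (h2 : p 0 * Real.cos (t + b) + p 1 * Real.sin (t + b) < R * Real.cos b) : False := by
  set X := p 0 * Real.cos t + p 1 * Real.sin t with hX
  set Y := -p 0 * Real.sin t + p 1 * Real.cos t with hY
  have hXR : X < R := by
    have e : X ^ 2 + Y ^ 2 = p 0 ^ 2 + p 1 ^ 2 := by
      rw [hX, hY]; linear_combination (p 0 ^ 2 + p 1 ^ 2) * Real.sin_sq_add_cos_sq t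
    apply lt_of_pow_lt_pow_left₀ 2 hR.le
    nlinarith [sq_nonneg Y]
  rw [Real.cos_add, Real.sin_add] at h1 h2
  have h1' : (R - X) * Real.cos a < Y * Real.sin a := by rw [hX, hY]; linarith
  have h2' : Y * Real.sin b < (R - X) * Real.cos b := by rw [hX, hY]; linarith
  have sa := Real.sin_nonneg_of_nonneg_of_le_pi ha (hab.trans hb)
  have sb := Real.sin_nonneg_of_nonneg_of_le_pi (ha.trans hab) hb
  have sab := Real.sin_nonneg_of_nonneg_of_le_pi (sub_nonneg.2 hab) (by linarith)
  have k1 := mul_le_mul_of_nonneg_right h1'.le sb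
  have k2 := mul_le_mul_of_nonneg_right h2'.le sa
  have k3 : (R - X) * Real.sin (b - a) ≤ 0 := by rw [Real.sin_sub]; linarith
  have k4 : Real.sin (b - a) = 0 := by
    apply le_antisymm _ sab
    by_contra hh
    push Not at hh
    have := mul_pos (sub_pos.2 hXR) hh
    linarith
  by_cases hba : b - a < Real.pi
  · have : b - a = 0 := by
      rcases (sub_nonneg.2 hab).eq_or_lt with h | h
      · exact h.symm
      · exact absurd k4 (Real.sin_pos_of_pos_of_lt_pi h hba).ne'
    have : b = a := by linarith
    subst this; linarith
  · have a0 : a = 0 := by linarith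
    have bp : b = Real.pi := by linarith
    subst a0 bp
    simp at h1' h2'
    linarith

/-- the three oriented lines -/
noncomputable def rr (R : ℝ) (t : Fin 6 → ℝ) : Fin 3 → Plane → ℝ :=
  ![fun p => cs R (t 0) (t 3) p, fun p => - cs R (t 1) (t 4) p, fun p => cs R (t 2) (t 5) p]

def sg : Fin 6 → ℝ := ![1, -1, 1, -1, 1, -1]
def ia : Fin 6 → Fin 3 := ![0, 1, 2, 0, 1, 2]
def ib : Fin 6 → Fin 3 := ![1, 2, 0, 1, 2, 0]

lemma face (R : ℝ) (t : Fin 6 → ℝ) (p : Plane) (hR : 0 < R) (hp : p 0 ^ 2 + p 1 ^ 2 < R ^ 2)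
    (h0 : t 0 = 0) (h01 : t 0 ≤ t 1) (h12 : t 1 ≤ t 2) (h23 : t 2 ≤ t 3) (h34 : t 3 ≤ t 4)
    (h45 : t 4 ≤ t 5) (h5 : t 5 ≤ 2 * Real.pi) (i : Fin 6)
    (hi : ![t 0, t 1, t 2, t 3, t 4, t 5] i = ![t 1, t 2, t 3, t 4, t 5, 2 * Real.pi] i)
    (ha : 0 < sg i * rr R t (ia i) p) (hb : 0 < sg i * rr R t (ib i) p) : False := by
  have W := fun t a b => wedge R t a b p hR hp
  fin_cases i <;> simp [sg, ia, ib, rr, cs, h0] at ha hb hi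
  · refine W 0 (t 3 / 2) (t 4 / 2) (by linarith) (by linarith) (by linarith) ?_ ?_
    · simp; linarith
    · simp; rw [← hi] at hb; simp at hb; linarith
  · refine W (t 1) ((t 4 - t 1) / 2) ((t 5 - t 1) / 2) (by linarith) (by linarith) (by linarith) ?_ ?_
    · rw [show t 1 + (t 4 - t 1) / 2 = (t 1 + t 4) / 2 by ring]; linarith
    · rw [show t 1 + (t 5 - t 1) / 2 = (t 1 + t 5) / 2 by ring]; rw [← hi] at hb; linarith
  · refine W (t 2) ((t 5 - t 2) / 2) (Real.pi - t 2 / 2) (by linarith) (by linarith) (by linarith) ?_ ?_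
    · rw [show t 2 + (t 5 - t 2) / 2 = (t 2 + t 5) / 2 by ring]; linarith
    · rw [show t 2 + (Real.pi - t 2 / 2) = t 2 / 2 + Real.pi by ring]; rw [← hi] at hb
      simp only [Real.cos_add_pi, Real.sin_add_pi, Real.cos_pi_sub]
      linarith
  · refine W (t 3) (Real.pi - t 3 / 2) (Real.pi - (t 3 - t 1) / 2) (by linarith) (by linarith) (by linarith) ?_ ?_
    · rw [show t 3 + (Real.pi - t 3 / 2) = t 3 / 2 + Real.pi by ring]
      simp only [Real.cos_add_pi, Real.sin_add_pi, Real.cos_pi_sub]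
      linarith
    · rw [show t 3 + (Real.pi - (t 3 - t 1) / 2) = (t 1 + t 3) / 2 + Real.pi by ring]; rw [← hi] at hb
      simp only [Real.cos_add_pi, Real.sin_add_pi, Real.cos_pi_sub]
      linarith
  · refine W (t 4) (Real.pi - (t 4 - t 1) / 2) (Real.pi - (t 4 - t 2) / 2) (by linarith) (by linarith) (by linarith) ?_ ?_
    · rw [show t 4 + (Real.pi - (t 4 - t 1) / 2) = (t 1 + t 4) / 2 + Real.pi by ring]
      simp only [Real.cos_add_pi, Real.sin_add_pi, Real.cos_pi_sub]
      linarith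
    · rw [show t 4 + (Real.pi - (t 4 - t 2) / 2) = (t 2 + t 4) / 2 + Real.pi by ring]; rw [← hi] at hb
      simp only [Real.cos_add_pi, Real.sin_add_pi, Real.cos_pi_sub]
      linarith
  · refine W 0 (t 2 / 2) (t 3 / 2) (by linarith) (by linarith) (by linarith) ?_ ?_
    · rw [hi] at ha
      rw [show (t 2 + 2 * Real.pi) / 2 = t 2 / 2 + Real.pi by ring,
        show (2 * Real.pi - t 2) / 2 = Real.pi - t 2 / 2 by ring] at ha
      simp only [Real.cos_add_pi, Real.sin_add_pi, Real.cos_pi_sub] at ha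
      simp; linarith
    · simp; linarith

lemma combo (R : ℝ) (t : Fin 6 → ℝ)
    (h0 : t 0 = 0) (h01 : t 0 < t 1) (h12 : t 1 < t 2) (h23 : t 2 < t 3) (h34 : t 3 < t 4)
    (h45 : t 4 < t 5) (h5 : t 5 < 2 * Real.pi) :
    ∃ α β γ c : ℝ, 0 < α ∧ 0 < β ∧ 0 < γ ∧
      ∀ p, α * rr R t 0 p + β * rr R t 1 p + γ * rr R t 2 p = c := by
  set m0 := (t 0 + t 3) / 2 with e0
  set m1 := (t 1 + t 4) / 2 with e1
  set m2 := (t 2 + t 5) / 2 with e2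
  refine ⟨Real.sin (m2 - m1), Real.sin (m2 - m0), Real.sin (m1 - m0),
    - Real.sin (m2 - m1) * (R * Real.cos ((t 3 - t 0) / 2))
    + Real.sin (m2 - m0) * (R * Real.cos ((t 4 - t 1) / 2))
    - Real.sin (m1 - m0) * (R * Real.cos ((t 5 - t 2) / 2)),
    Real.sin_pos_of_pos_of_lt_pi (by linarith) (by linarith),
    Real.sin_pos_of_pos_of_lt_pi (by linarith) (by linarith),
    Real.sin_pos_of_pos_of_lt_pi (by linarith) (by linarith), ?_⟩
  intro p
  simp only [rr, cs, Matrix.cons_val, ← e0, ← e1, ← e2, Real.sin_sub]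
  ring

end Geo

namespace Geo

/-- partial sums -/
noncomputable def ang (x : Fin 6 → ℝ) : Fin 6 → ℝ :=
  ![0, 2 * Real.pi * x 0, 2 * Real.pi * (x 0 + x 1), 2 * Real.pi * (x 0 + x 1 + x 2),
    2 * Real.pi * (x 0 + x 1 + x 2 + x 3), 2 * Real.pi * (x 0 + x 1 + x 2 + x 3 + x 4)]

lemma cont_rr (R : ℝ) (k : Fin 3) :
    Continuous fun z : (Fin 6 → ℝ) × Plane => rr R (ang z.1) k z.2 := by
  fin_cases k <;> simp [rr, cs, ang] <;> fun_prop

lemma comp_aux (f : (Fin 6 → ℝ) → Plane → ℝ) (hf : Continuous fun z : (Fin 6 → ℝ) × Plane => f z.1 z.2)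
    (x : Fin 6 → ℝ) : Continuous (f x) := by
  have h : Continuous fun p : Plane => (x, p) := by fun_prop
  exact hf.comp h

lemma cont_rr' (R : ℝ) (x : Fin 6 → ℝ) (k : Fin 3) : Continuous (rr R (ang x) k) :=
  comp_aux (fun x p => rr R (ang x) k p) (cont_rr R k) x

lemma open_aux (S : Set Plane) (hS : IsCompact S) (f g : (Fin 6 → ℝ) → Plane → ℝ)
    (hf : Continuous fun z : (Fin 6 → ℝ) × Plane => f z.1 z.2)
    (hg : Continuous fun z : (Fin 6 → ℝ) × Plane => g z.1 z.2) (e : ℝ) :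
    IsOpen {x | ∀ p ∈ S, 0 < e * f x p ∧ 0 < e * g x p} := by
  rw [isOpen_iff_eventually]
  intro x hx
  refine hS.eventually_forall_of_forall_eventually (x₀ := x)
    (P := fun x p => 0 < e * f x p ∧ 0 < e * g x p) ?_
  intro p hp
  have h := hx p hp
  have h1 : ∀ᶠ z in nhds (x, p), 0 < e * f z.1 z.2 :=
    (continuous_const.mul hf).continuousAt.eventually (lt_mem_nhds h.1)
  have h2 : ∀ᶠ z in nhds (x, p), 0 < e * g z.1 z.2 :=
    (continuous_const.mul hg).continuousAt.eventually (lt_mem_nhds h.2)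
  exact h1.and h2

lemma isLine_rr (R : ℝ) (t : Fin 6 → ℝ) (k : Fin 3) : IsLine {p | rr R t k p = 0} := by
  fin_cases k <;> simp [rr] <;> exact isLine_cs _ _ _

lemma rr_convex (R : ℝ) (t : Fin 6 → ℝ) (k : Fin 3) (e : ℝ) : Convex ℝ {p | 0 < e * rr R t k p} := by
  have key : ∀ a b : ℝ, ∀ p q : Plane, ∀ u v : ℝ, u + v = 1 →
      cs R a b (u • p + v • q) = u * cs R a b p + v * cs R a b q := by
    intro a b p q u v huv
    simp only [cs, PiLp.add_apply, PiLp.smul_apply, smul_eq_mul]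
    linear_combination (R * Real.cos ((b - a) / 2)) * huv
  have key2 : ∀ p q : Plane, ∀ u v : ℝ, u + v = 1 →
      rr R t k (u • p + v • q) = u * rr R t k p + v * rr R t k q := by
    intro p q u v huv
    fin_cases k <;> simp only [rr, Fin.zero_eta, Fin.mk_one, Fin.reduceFinMk, Matrix.cons_val] <;>
      rw [key _ _ p q u v huv]
    ring
  intro p hp q hq u v hu hv huv
  simp only [mem_ofPred_eq] at hp hq ⊢
  rw [key2 p q u v huv]
  have : e * (u * rr R t k p + v * rr R t k q) = u * (e * rr R t k p) + v * (e * rr R t k q) := by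
    ring
  rw [this]
  rcases hu.eq_or_lt with h | h
  · subst h
    have : v = 1 := by linarith
    subst this; linarith
  · have := mul_pos h hp
    have := mul_nonneg hv hq.le
    linarith

/-- Occupied sectors -/
def occ (F : Finset (Set Plane)) (R : ℝ) (i : Fin 6) : Set (Fin 6 → ℝ) :=
  ⋃ S ∈ F, {x | ∀ p ∈ S, 0 < sg i * rr R (ang x) (ia i) p ∧ 0 < sg i * rr R (ang x) (ib i) p}

lemma occ_open (F : Finset (Set Plane)) (hcpt : ∀ S ∈ F, IsCompact S) (R : ℝ) (i : Fin 6) :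
    IsOpen (occ F R i) := by
  refine isOpen_biUnion fun S hS => ?_
  exact open_aux S (hcpt S hS) (fun x p => rr R (ang x) (ia i) p)
    (fun x p => rr R (ang x) (ib i) p) (cont_rr R (ia i)) (cont_rr R (ib i)) (sg i)

lemma not_tight (R : ℝ) (t : Fin 6 → ℝ) (e : ℝ) (A B C : Set Plane)
    (hA : ∀ p ∈ A, 0 < e * rr R t 0 p ∧ 0 < e * rr R t 1 p)
    (hB : ∀ p ∈ B, 0 < e * rr R t 1 p ∧ 0 < e * rr R t 2 p)
    (hC : ∀ p ∈ C, 0 < e * rr R t 2 p ∧ 0 < e * rr R t 0 p) (hT : Tight A B C) :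
    ∃ p, ∀ k, 0 < e * rr R t k p := by
  obtain ⟨p, ⟨h1, h2⟩, h3⟩ := hT
  have g1 : p ∈ {p | 0 < e * rr R t 1 p} := convexHull_min
    (union_subset (fun q hq => (hA q hq).2) (fun q hq => (hB q hq).1)) (rr_convex R t 1 e) h1
  have g2 : p ∈ {p | 0 < e * rr R t 0 p} := convexHull_min
    (union_subset (fun q hq => (hA q hq).1) (fun q hq => (hC q hq).2)) (rr_convex R t 0 e) h2
  have g3 : p ∈ {p | 0 < e * rr R t 2 p} := convexHull_min
    (union_subset (fun q hq => (hB q hq).2) (fun q hq => (hC q hq).1)) (rr_convex R t 2 e) h3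
  refine ⟨p, fun k => ?_⟩
  fin_cases k
  · exact g2
  · exact g1
  · exact g3

lemma sign_const (S : Set Plane) (hS : IsConnected S) (f : Plane → ℝ) (hf : Continuous f)
    (h : ∀ p ∈ S, f p ≠ 0) : (∀ p ∈ S, 0 < f p) ∨ (∀ p ∈ S, f p < 0) := by
  by_contra hcon
  push Not at hcon
  obtain ⟨⟨p, hp, h1⟩, q, hq, h2⟩ := hcon
  obtain ⟨z, hz, hz0⟩ := hS.isPreconnected.intermediate_value hp hq hf.continuousOn ⟨h1, h2⟩
  exact h z hz hz0

end Geo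

open scoped Classical in
theorem stmt_4 (F : Finset (Set Plane))
    (hne : ∀ S ∈ F, S.Nonempty)
    (hcpt : ∀ S ∈ F, IsCompact S)
    (hconn : ∀ S ∈ F, IsConnected S)
    (htight : ∀ A ∈ F, ∀ B ∈ F, ∀ C ∈ F, Tight A B C) :
    ∃ l : Set Plane, IsLine l ∧
      (F.card : ℝ) / 3 ≤ (F.filter (fun S => (S ∩ l).Nonempty)).card := by
  by_contra hcon
  push Not at hcon
  -- a large disc
  obtain ⟨R, hR, hball⟩ : ∃ R : ℝ, 0 < R ∧ ∀ S ∈ F, ∀ p ∈ S, p 0 ^ 2 + p 1 ^ 2 < R ^ 2 := by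
    have hc : IsCompact (⋃ S ∈ F, S) := F.isCompact_biUnion hcpt
    obtain ⟨R, hR, hsub⟩ := hc.isBounded.subset_ball_lt 0 (0 : Plane)
    refine ⟨R, hR, fun S hS p hp => ?_⟩
    have : p ∈ Metric.ball (0 : Plane) R := hsub (mem_biUnion hS hp)
    rw [mem_ball_zero_iff] at this
    have h2 := EuclideanSpace.norm_sq_eq p
    rw [Fin.sum_univ_two] at h2
    simp only [Real.norm_eq_abs, sq_abs] at h2
    rw [← h2]
    exact pow_lt_pow_left₀ this (norm_nonneg _) two_ne_zero
  have hsum : ∀ x ∈ stdSimplex ℝ (Fin 6), x 0 + x 1 + x 2 + x 3 + x 4 + x 5 = 1 := by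
    intro x hx
    have := hx.2
    rwa [Fin.sum_univ_six] at this
  have hpi := Real.pi_pos
  -- some set avoids the three lines
  have hcover : stdSimplex ℝ (Fin 6) ⊆ ⋃ i, Geo.occ F R i := by
    intro x _
    have hex : ∃ S ∈ F, ∀ k, ∀ p ∈ S, Geo.rr R (Geo.ang x) k p ≠ 0 := by
      by_contra hno
      push Not at hno
      set l : Fin 3 → Set Plane := fun k => {p | Geo.rr R (Geo.ang x) k p = 0} with hl
      have hsub : F ⊆ (Finset.univ : Finset (Fin 3)).biUnion
          fun k => F.filter (fun S => (S ∩ l k).Nonempty) := by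
        intro S hS
        obtain ⟨k, p, hp, h0⟩ := hno S hS
        simp only [Finset.mem_biUnion, Finset.mem_univ, true_and, Finset.mem_filter]
        exact ⟨k, hS, p, hp, h0⟩
      have hle := (Finset.card_le_card hsub).trans Finset.card_biUnion_le
      rw [Fin.sum_univ_three] at hle
      have e0 := hcon (l 0) (Geo.isLine_rr _ _ _)
      have e1 := hcon (l 1) (Geo.isLine_rr _ _ _)
      have e2 := hcon (l 2) (Geo.isLine_rr _ _ _)
      have hle' : (F.card : ℝ) ≤ (F.filter (fun S => (S ∩ l 0).Nonempty)).card +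
        (F.filter (fun S => (S ∩ l 1).Nonempty)).card +
        (F.filter (fun S => (S ∩ l 2).Nonempty)).card := by exact_mod_cast hle
      linarith
    obtain ⟨S, hS, hav⟩ := hex
    have hs := fun k => Geo.sign_const S (hconn S hS) _ (Geo.cont_rr' R x k) (hav k)
    have hmk : ∀ i : Fin 6, (∀ p ∈ S, 0 < Geo.sg i * Geo.rr R (Geo.ang x) (Geo.ia i) p) →
        (∀ p ∈ S, 0 < Geo.sg i * Geo.rr R (Geo.ang x) (Geo.ib i) p) →
        x ∈ ⋃ i, Geo.occ F R i := by
      intro i h1 h2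
      refine mem_iUnion.2 ⟨i, ?_⟩
      refine mem_biUnion (show S ∈ (F : Set (Set Plane)) from hS) ?_
      exact fun p hp => ⟨h1 p hp, h2 p hp⟩
    rcases hs 0 with h0 | h0 <;> rcases hs 1 with h1 | h1 <;> rcases hs 2 with h2 | h2
    · exact hmk 0 (by simpa [Geo.sg, Geo.ia] using h0) (by simpa [Geo.sg, Geo.ib] using h1)
    · exact hmk 0 (by simpa [Geo.sg, Geo.ia] using h0) (by simpa [Geo.sg, Geo.ib] using h1)
    · exact hmk 2 (by simpa [Geo.sg, Geo.ia] using h2) (by simpa [Geo.sg, Geo.ib] using h0)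
    · exact hmk 1 (by simpa [Geo.sg, Geo.ia] using h1) (by simpa [Geo.sg, Geo.ib] using h2)
    · exact hmk 4 (by simpa [Geo.sg, Geo.ia] using h1) (by simpa [Geo.sg, Geo.ib] using h2)
    · exact hmk 5 (by simpa [Geo.sg, Geo.ia] using h2) (by simpa [Geo.sg, Geo.ib] using h0)
    · exact hmk 3 (by simpa [Geo.sg, Geo.ia] using h0) (by simpa [Geo.sg, Geo.ib] using h1)
    · exact hmk 3 (by simpa [Geo.sg, Geo.ia] using h0) (by simpa [Geo.sg, Geo.ib] using h1)
  have hface : ∀ i, ∀ x ∈ stdSimplex ℝ (Fin 6), x i = 0 → x ∉ Geo.occ F R i := by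
    intro i x hx hxi hocc
    simp only [Geo.occ, mem_iUnion] at hocc
    obtain ⟨S, hS, hq⟩ := hocc
    obtain ⟨p, hp⟩ := hne S hS
    have hq' := hq p hp
    have hm : ∀ j, 0 ≤ 2 * Real.pi * x j := fun j => mul_nonneg (by linarith) (hx.1 j)
    have m0 := hm 0
    have m1 := hm 1
    have m2 := hm 2
    have m3 := hm 3
    have m4 := hm 4
    have m5 := hm 5
    have hs : 2 * Real.pi * (x 0 + x 1 + x 2 + x 3 + x 4 + x 5) = 2 * Real.pi := by
      rw [hsum x hx, mul_one]
    refine Geo.face R (Geo.ang x) p hR (hball S hS p hp) ?_ ?_ ?_ ?_ ?_ ?_ ?_ i ?_ hq'.1 hq'.2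
    · simp [Geo.ang]
    · simp only [Geo.ang, Matrix.cons_val]; linarith
    · simp only [Geo.ang, Matrix.cons_val]; linarith
    · simp only [Geo.ang, Matrix.cons_val]; linarith
    · simp only [Geo.ang, Matrix.cons_val]; linarith
    · simp only [Geo.ang, Matrix.cons_val]; linarith
    · simp only [Geo.ang, Matrix.cons_val]; linarith
    · fin_cases i <;> simp only [Fin.zero_eta, Fin.mk_one, Fin.reduceFinMk, Fin.isValue] at hxi <;>
        simp only [Geo.ang, Fin.zero_eta, Fin.mk_one, Fin.reduceFinMk, Matrix.cons_val] <;>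
        (try simp only [hxi, add_zero, zero_add, mul_zero] at hs ⊢) <;> linarith
  obtain ⟨x, hx, hall⟩ := Sp.kkm (Geo.occ F R) (Geo.occ_open F hcpt R) hcover hface
  have hpos : ∀ i, 0 < x i := fun i =>
    lt_of_le_of_ne (hx.1 i) fun h => hface i x hx h.symm (hall i)
  have hm : ∀ j, 0 < 2 * Real.pi * x j := fun j => mul_pos (by linarith) (hpos j)
  have m0 := hm 0
  have m1 := hm 1
  have m2 := hm 2
  have m3 := hm 3
  have m4 := hm 4
  have m5 := hm 5
  have hs : 2 * Real.pi * (x 0 + x 1 + x 2 + x 3 + x 4 + x 5) = 2 * Real.pi := by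
    rw [hsum x hx, mul_one]
  obtain ⟨α, β, γ, c, hα, hβ, hγ, hc⟩ := Geo.combo R (Geo.ang x) (by simp [Geo.ang])
    (by simp only [Geo.ang, Matrix.cons_val]; linarith)
    (by simp only [Geo.ang, Matrix.cons_val]; linarith)
    (by simp only [Geo.ang, Matrix.cons_val]; linarith)
    (by simp only [Geo.ang, Matrix.cons_val]; linarith)
    (by simp only [Geo.ang, Matrix.cons_val]; linarith)
    (by simp only [Geo.ang, Matrix.cons_val]; linarith)
  have hS : ∀ i, ∃ S ∈ F, ∀ p ∈ S, 0 < Geo.sg i * Geo.rr R (Geo.ang x) (Geo.ia i) p ∧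
      0 < Geo.sg i * Geo.rr R (Geo.ang x) (Geo.ib i) p := by
    intro i
    have := hall i
    simp only [Geo.occ, mem_iUnion] at this
    obtain ⟨S, hS, hq⟩ := this
    exact ⟨S, hS, hq⟩
  choose S hSF hSp using hS
  obtain ⟨p, hp⟩ := Geo.not_tight R (Geo.ang x) 1 (S 0) (S 4) (S 2) (hSp 0) (hSp 4) (hSp 2)
    (htight _ (hSF 0) _ (hSF 4) _ (hSF 2))
  obtain ⟨q, hq⟩ := Geo.not_tight R (Geo.ang x) (-1) (S 3) (S 1) (S 5) (hSp 3) (hSp 1) (hSp 5)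
    (htight _ (hSF 3) _ (hSF 1) _ (hSF 5))
  have cp := hc p
  have cq := hc q
  have p0 := mul_pos hα (hp 0)
  have p1 := mul_pos hβ (hp 1)
  have p2 := mul_pos hγ (hp 2)
  have q0 := mul_pos hα (hq 0)
  have q1 := mul_pos hβ (hq 1)
  have q2 := mul_pos hγ (hq 2)
  linarith
end

section
/- Let F be a family of nonempty compact convex sets in ℝ² such that every four members of F have a common line transversal (property T(4)). Then F is pierced by 2 lines. -/
open Set

open Filter Topology

section core
variable {ι : Type*}

def LE' (xl : ι → ℝ) (lo hi : ι → ℝ → ℝ) (s m : ℝ) : Prop :=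
  ∃ i j, s < xl i ∧ s < xl j ∧ hi j m < lo i m
def LW (xr : ι → ℝ) (lo hi : ι → ℝ → ℝ) (s m : ℝ) : Prop :=
  ∃ i j, xr i < s ∧ xr j < s ∧ hi j m < lo i m
def LP (xl xr : ι → ℝ) (lo hi : ι → ℝ → ℝ) (s m : ℝ) : Prop :=
  ∃ i j, s < xl i ∧ xr j < s ∧ hi j m < lo i m
def LQ (xl xr : ι → ℝ) (lo hi : ι → ℝ → ℝ) (s m : ℝ) : Prop :=
  ∃ i j, xr i < s ∧ s < xl j ∧ hi j m < lo i m

lemma isOpen_aux {lo hi : ι → ℝ → ℝ} (hlo : ∀ i, Continuous (lo i)) (hhi : ∀ i, Continuous (hi i))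
    (A B : ι → ℝ → Prop) (hA : ∀ i, IsOpen {s | A i s}) (hB : ∀ i, IsOpen {s | B i s}) :
    IsOpen {p : ℝ × ℝ | ∃ i j, A i p.1 ∧ B j p.1 ∧ hi j p.2 < lo i p.2} := by
  simp only [ofPred_exists]
  refine isOpen_iUnion fun i => isOpen_iUnion fun j => ?_
  refine ((hA i).preimage continuous_fst).inter (((hB j).preimage continuous_fst).inter ?_)
  exact isOpen_lt ((hhi j).comp continuous_snd) ((hlo i).comp continuous_snd)

lemma slice1 {R : ℝ → ℝ → Prop} (h : IsOpen {p : ℝ × ℝ | R p.1 p.2}) (m : ℝ) :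
    IsOpen {s | R s m} :=
  h.preimage (f := fun s => (s, m)) (by fun_prop)

lemma slice2 {R : ℝ → ℝ → Prop} (h : IsOpen {p : ℝ × ℝ | R p.1 p.2}) (s : ℝ) :
    IsOpen {m | R s m} :=
  h.preimage (f := fun m => (s, m)) (by fun_prop)

def TypeR (E W P : ℝ → ℝ → Prop) (m : ℝ) : Prop :=
  ∃ s₁ s₂, s₁ ≤ s₂ ∧ E s₁ m ∧ W s₂ m ∧ ∀ s ∈ Icc s₁ s₂, P s m

lemma typeR_open {E W P : ℝ → ℝ → Prop} (hE : IsOpen {p : ℝ × ℝ | E p.1 p.2})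
    (hW : IsOpen {p : ℝ × ℝ | W p.1 p.2}) (hP : IsOpen {p : ℝ × ℝ | P p.1 p.2}) :
    IsOpen {m | TypeR E W P m} := by
  rw [isOpen_iff_mem_nhds]
  rintro m ⟨s₁, s₂, h, hE1, hW2, hPs⟩
  have h1 := (slice2 hE s₁).mem_nhds hE1
  have h2 := (slice2 hW s₂).mem_nhds hW2
  have h3 : ∀ᶠ m' in 𝓝 m, ∀ s ∈ Icc s₁ s₂, P s m' := by
    refine isCompact_Icc.eventually_forall_of_forall_eventually fun s hs => ?_
    have : {p : ℝ × ℝ | P p.2 p.1} ∈ 𝓝 (m, s) :=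
      (hP.preimage (continuous_swap)).mem_nhds (hPs s hs)
    exact this
  filter_upwards [h1, h2, h3] with m' a b c
  exact ⟨s₁, s₂, h, a, b, c⟩

/-- extension of an open set containing `[e,w]` -/
lemma extend_Icc {P : ℝ → Prop} (hP : IsOpen {s | P s}) {e w : ℝ} (hew : e ≤ w)
    (h : ∀ s ∈ Icc e w, P s) : ∃ s₁ s₂, s₁ < e ∧ w < s₂ ∧ ∀ s ∈ Icc s₁ s₂, P s := by
  obtain ⟨ε, hε, h1⟩ := Metric.isOpen_iff.1 hP e (h e ⟨le_rfl, hew⟩)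
  obtain ⟨δ, hδ, h2⟩ := Metric.isOpen_iff.1 hP w (h w ⟨hew, le_rfl⟩)
  refine ⟨e - ε / 2, w + δ / 2, by linarith, by linarith, fun s hs => ?_⟩
  by_cases a : s < e
  · apply h1
    rw [Metric.mem_ball, Real.dist_eq, abs_lt]
    constructor <;> linarith [hs.1]
  by_cases b : w < s
  · apply h2
    rw [Metric.mem_ball, Real.dist_eq, abs_lt]
    constructor <;> linarith [hs.2]
  · exact h s ⟨not_lt.1 a, not_lt.1 b⟩

lemma conn_Icc {P Q : ℝ → Prop} (hP : IsOpen {s | P s}) (hQ : IsOpen {s | Q s}) {a b : ℝ}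
    (hcov : ∀ s ∈ Icc a b, P s ∨ Q s) {p q : ℝ} (hp : p ∈ Icc a b) (hq : q ∈ Icc a b)
    (hPp : P p) (hQq : Q q) : ∃ s ∈ Icc a b, P s ∧ Q s := by
  obtain ⟨s, hs, h⟩ := isPreconnected_Icc (a := a) (b := b) _ _ hP hQ hcov ⟨p, hp, hPp⟩ ⟨q, hq, hQq⟩
  exact ⟨s, hs, h⟩

lemma fixed_m {E W P Q : ℝ → Prop} {e w : ℝ} (hE : ∀ s, E s ↔ s < e) (hW : ∀ s, W s ↔ w < s)
    (hP : IsOpen {s | P s}) (hQ : IsOpen {s | Q s})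
    (hcov : ∀ s, E s ∨ W s ∨ P s ∨ Q s)
    (hEW : ∀ s, E s → W s → P s ∨ Q s)
    (hPQ : ∀ s, P s → Q s → E s ∨ W s)
    (hall : ∀ s, E s → W s → P s → Q s → False) :
    ((∃ s₁ s₂, s₁ ≤ s₂ ∧ E s₁ ∧ W s₂ ∧ ∀ s ∈ Icc s₁ s₂, P s) ∨
     (∃ s₁ s₂, s₁ ≤ s₂ ∧ E s₁ ∧ W s₂ ∧ ∀ s ∈ Icc s₁ s₂, Q s)) ∧
    ¬ ((∃ s₁ s₂, s₁ ≤ s₂ ∧ E s₁ ∧ W s₂ ∧ ∀ s ∈ Icc s₁ s₂, P s) ∧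
     (∃ s₁ s₂, s₁ ≤ s₂ ∧ E s₁ ∧ W s₂ ∧ ∀ s ∈ Icc s₁ s₂, Q s)) := by
  simp only [hE, hW] at *
  constructor
  · rcases lt_or_ge w e with h | h
    · obtain ⟨s, h1, h2⟩ := exists_between h
      rcases hEW s h2 h1 with hp | hq
      · exact Or.inl ⟨s, s, le_rfl, h2, h1, fun t ht => by
          rw [Icc_self] at ht; rw [ht]; exact hp⟩
      · exact Or.inr ⟨s, s, le_rfl, h2, h1, fun t ht => by
          rw [Icc_self] at ht; rw [ht]; exact hq⟩
    · have hc : ∀ s ∈ Icc e w, P s ∨ Q s := fun s hs => by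
        rcases hcov s with a | a | a | a
        · exact absurd hs.1 (not_le.2 a)
        · exact absurd hs.2 (not_le.2 a)
        · exact Or.inl a
        · exact Or.inr a
      have hn : ¬ ∃ s ∈ Icc e w, P s ∧ Q s := by
        rintro ⟨s, hs, a, b⟩
        rcases hPQ s a b with c | c
        · exact absurd hs.1 (not_le.2 c)
        · exact absurd hs.2 (not_le.2 c)
      by_cases hp : ∀ s ∈ Icc e w, P s
      · obtain ⟨s₁, s₂, a, b, c⟩ := extend_Icc hP h hp
        exact Or.inl ⟨s₁, s₂, by linarith, a, b, c⟩
      · have hq : ∀ s ∈ Icc e w, Q s := by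
          push Not at hp
          obtain ⟨q, hq, hq'⟩ := hp
          intro s hs
          by_contra hs'
          exact hn (conn_Icc hP hQ hc hs hq ((hc s hs).resolve_right hs')
            ((hc q hq).resolve_left hq'))
        obtain ⟨s₁, s₂, a, b, c⟩ := extend_Icc hQ h hq
        exact Or.inr ⟨s₁, s₂, by linarith, a, b, c⟩
  · rintro ⟨⟨s₁, s₂, h, a, b, c⟩, ⟨t₁, t₂, h', a', b', c'⟩⟩
    rcases lt_or_ge w e with hwe | hwe
    · have key : ∀ s₁ s₂ : ℝ, s₁ ≤ s₂ → s₁ < e → w < s₂ → ∃ s ∈ Icc s₁ s₂, w < s ∧ s < e := by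
        intro s₁ s₂ h a b
        obtain ⟨s, hs1, hs2⟩ := exists_between hwe
        by_cases h1 : s < s₁
        · exact ⟨s₁, ⟨le_rfl, h⟩, by linarith, a⟩
        by_cases h2 : s₂ < s
        · exact ⟨s₂, ⟨h, le_rfl⟩, b, by linarith⟩
        exact ⟨s, ⟨not_lt.1 h1, not_lt.1 h2⟩, hs1, hs2⟩
      obtain ⟨s, hs, hs1, hs2⟩ := key s₁ s₂ h a b
      obtain ⟨t, ht, ht1, ht2⟩ := key t₁ t₂ h' a' b'
      have hb : ∀ r ∈ Icc (min s t) (max s t), w < r ∧ r < e := fun r hr =>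
        ⟨lt_of_lt_of_le (lt_min hs1 ht1) hr.1, lt_of_le_of_lt hr.2 (max_lt hs2 ht2)⟩
      obtain ⟨r, hr, hp, hq⟩ := conn_Icc hP hQ (fun r hr => hEW r (hb r hr).2 (hb r hr).1)
        (p := s) (q := t) ⟨min_le_left _ _, le_max_left _ _⟩ ⟨min_le_right _ _, le_max_right _ _⟩
        (c s hs) (c' t ht)
      exact hall r (hb r hr).2 (hb r hr).1 hp hq
    · have hp := c e ⟨a.le, by linarith⟩
      have hq := c' e ⟨a'.le, by linarith⟩
      rcases hPQ e hp hq with x | x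
      · exact lt_irrefl _ x
      · exact absurd hwe (not_le.2 x)

lemma exists_cut_E {E : ℝ → Prop} (ho : IsOpen {s | E s}) (hd : ∀ s t, s ≤ t → E t → E s)
    {a b : ℝ} (ha : E a) (hb : ¬ E b) : ∃ e, ∀ s, E s ↔ s < e := by
  have hbd : BddAbove {s | E s} := ⟨b, fun s hs => by
    by_contra h; exact hb (hd _ _ (not_le.1 h).le hs)⟩
  refine ⟨sSup {s | E s}, fun s => ⟨fun hs => ?_, fun hs => ?_⟩⟩
  · obtain ⟨ε, hε, h1⟩ := Metric.isOpen_iff.1 ho s hs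
    have : s + ε / 2 ∈ {s | E s} := h1 (by
      rw [Metric.mem_ball, Real.dist_eq, abs_lt]; constructor <;> linarith)
    linarith [le_csSup hbd this]
  · obtain ⟨t, ht, hst⟩ := exists_lt_of_lt_csSup ⟨a, ha⟩ hs
    exact hd _ _ hst.le ht

lemma exists_cut_W {W : ℝ → Prop} (ho : IsOpen {s | W s}) (hd : ∀ s t, s ≤ t → W s → W t)
    {a b : ℝ} (ha : W a) (hb : ¬ W b) : ∃ w, ∀ s, W s ↔ w < s := by
  obtain ⟨e, he⟩ := exists_cut_E (E := fun s => W (-s)) (ho.preimage continuous_neg)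
    (fun s t h => hd _ _ (neg_le_neg h)) (a := -a) (b := -b) (by simpa using ha) (by simpa using hb)
  refine ⟨-e, fun s => ?_⟩
  have := he (-s)
  rw [neg_neg] at this
  rw [this, neg_lt]

theorem core [Finite ι] (xl xr : ι → ℝ) (lo hi : ι → ℝ → ℝ)
    (hl : ∀ i m, lo i m ≤ hi i m)
    (hlo : ∀ i, Continuous (lo i)) (hhi : ∀ i, Continuous (hi i))
    (asB : ∀ᶠ m in atBot, ∀ i j, xr j < xl i → hi j m < lo i m)
    (asT : ∀ᶠ m in atTop, ∀ i j, xr j < xl i → hi i m < lo j m)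
    (noAll : ∀ s c m i₁ i₂ i₃ i₄, s < xl i₁ → c < lo i₁ m → s < xl i₂ → hi i₂ m < c →
      xr i₃ < s → c < lo i₃ m → xr i₄ < s → hi i₄ m < c → False) :
    ∃ s m c, ∀ i, (xl i ≤ s ∧ s ≤ xr i) ∨ (lo i m ≤ c ∧ c ≤ hi i m) := by
  classical
  by_cases hcov : ∀ s m, LE' xl lo hi s m ∨ LW xr lo hi s m ∨ LP xl xr lo hi s m ∨
      LQ xl xr lo hi s m
  swap
  · push Not at hcov
    obtain ⟨s, m, h1, h2, h3, h4⟩ := hcov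
    simp only [LE', LW, LP, LQ, not_exists, not_and, not_lt] at h1 h2 h3 h4
    have hJ : ∀ i j, (s < xl i ∨ xr i < s) → (s < xl j ∨ xr j < s) → lo i m ≤ hi j m := by
      rintro i j (a | a) (b | b)
      · exact h1 i j a b
      · exact h3 i j a b
      · exact h4 i j a b
      · exact h2 i j a b
    let J : Set ι := {i | s < xl i ∨ xr i < s}
    refine ⟨s, m, sSup ((fun i => lo i m) '' J), fun i => ?_⟩
    by_cases hi' : i ∈ J
    · right
      constructor
      · exact le_csSup ((Set.toFinite J).image _).bddAbove ⟨i, hi', rfl⟩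
      · refine csSup_le ⟨_, i, hi', rfl⟩ ?_
        rintro _ ⟨j, hj, rfl⟩
        exact hJ j i hj hi'
    · left
      simp only [J, mem_ofPred_eq, not_or, not_lt] at hi'
      exact hi'
  exfalso
  have oE : IsOpen {p : ℝ × ℝ | LE' xl lo hi p.1 p.2} :=
    isOpen_aux hlo hhi (fun i s => s < xl i) (fun i s => s < xl i)
      (fun i => isOpen_Iio) (fun i => isOpen_Iio)
  have oW : IsOpen {p : ℝ × ℝ | LW xr lo hi p.1 p.2} :=
    isOpen_aux hlo hhi (fun i s => xr i < s) (fun i s => xr i < s)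
      (fun i => isOpen_Ioi) (fun i => isOpen_Ioi)
  have oP : IsOpen {p : ℝ × ℝ | LP xl xr lo hi p.1 p.2} :=
    isOpen_aux hlo hhi (fun i s => s < xl i) (fun i s => xr i < s)
      (fun i => isOpen_Iio) (fun i => isOpen_Ioi)
  have oQ : IsOpen {p : ℝ × ℝ | LQ xl xr lo hi p.1 p.2} :=
    isOpen_aux hlo hhi (fun i s => xr i < s) (fun i s => s < xl i)
      (fun i => isOpen_Ioi) (fun i => isOpen_Iio)
  obtain ⟨M1, hM1⟩ := (Set.finite_range xl).bddAbove
  obtain ⟨M2, hM2⟩ := (Set.finite_range xr).bddAbove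
  obtain ⟨N1, hN1⟩ := (Set.finite_range xl).bddBelow
  obtain ⟨N2, hN2⟩ := (Set.finite_range xr).bddBelow
  replace hM1 : ∀ i, xl i ≤ M1 := fun i => hM1 ⟨i, rfl⟩
  replace hM2 : ∀ i, xr i ≤ M2 := fun i => hM2 ⟨i, rfl⟩
  replace hN1 : ∀ i, N1 ≤ xl i := fun i => hN1 ⟨i, rfl⟩
  replace hN2 : ∀ i, N2 ≤ xr i := fun i => hN2 ⟨i, rfl⟩
  have main : ∀ m, (TypeR (LE' xl lo hi) (LW xr lo hi) (LP xl xr lo hi) m ∨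
      TypeR (LE' xl lo hi) (LW xr lo hi) (LQ xl xr lo hi) m) ∧
      ¬ (TypeR (LE' xl lo hi) (LW xr lo hi) (LP xl xr lo hi) m ∧
      TypeR (LE' xl lo hi) (LW xr lo hi) (LQ xl xr lo hi) m) := by
    intro m
    obtain ⟨e, he⟩ := exists_cut_E (slice1 oE m)
      (by rintro s t hst ⟨i, j, a, b, c⟩; exact ⟨i, j, by linarith, by linarith, c⟩)
      (a := N2 - 1) (b := M1)
      (by
        rcases hcov (N2 - 1) m with h | ⟨i, j, a, b, c⟩ | ⟨i, j, a, b, c⟩ | ⟨i, j, a, b, c⟩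
        · exact h
        · linarith [hN2 i]
        · linarith [hN2 j]
        · linarith [hN2 i])
      (by rintro ⟨i, j, a, b, c⟩; linarith [hM1 i])
    obtain ⟨w, hw⟩ := exists_cut_W (slice1 oW m)
      (by rintro s t hst ⟨i, j, a, b, c⟩; exact ⟨i, j, by linarith, by linarith, c⟩)
      (a := M1 + 1) (b := N2)
      (by
        rcases hcov (M1 + 1) m with ⟨i, j, a, b, c⟩ | h | ⟨i, j, a, b, c⟩ | ⟨i, j, a, b, c⟩
        · linarith [hM1 i]
        · exact h
        · linarith [hM1 i]
        · linarith [hM1 j])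
      (by rintro ⟨i, j, a, b, c⟩; linarith [hN2 i])
    refine fixed_m (E := fun s => LE' xl lo hi s m) (W := fun s => LW xr lo hi s m)
      (P := fun s => LP xl xr lo hi s m) (Q := fun s => LQ xl xr lo hi s m)
      he hw (slice1 oP m) (slice1 oQ m) (fun s => hcov s m) ?_ ?_ ?_
    · rintro s ⟨i, j, a, b, c⟩ ⟨i', j', a', b', c'⟩
      by_cases h : hi j' m < lo i m
      · exact Or.inl ⟨i, j', a, b', h⟩
      · exact Or.inr ⟨i', j, a', b, by linarith⟩
    · rintro s ⟨i, j, a, b, c⟩ ⟨i', j', a', b', c'⟩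
      by_cases h : hi j' m < lo i m
      · exact Or.inl ⟨i, j', a, b', h⟩
      · exact Or.inr ⟨i', j, a', b, by linarith⟩
    · rintro s ⟨i, j, a, b, c⟩ ⟨i', j', a', b', c'⟩ ⟨p, q, a₁, b₁, c₁⟩ ⟨p', q', a₂, b₂, c₂⟩
      obtain ⟨ne, n1, n2, n3⟩ : ∃ k, s < xl k ∧ lo i m ≤ lo k m ∧ lo p m ≤ lo k m := by
        rcases le_total (lo i m) (lo p m) with h | h
        · exact ⟨p, a₁, h, le_rfl⟩
        · exact ⟨i, a, le_rfl, h⟩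
      obtain ⟨nw, n4, n5, n6⟩ : ∃ k, xr k < s ∧ lo i' m ≤ lo k m ∧ lo p' m ≤ lo k m := by
        rcases le_total (lo i' m) (lo p' m) with h | h
        · exact ⟨p', a₂, h, le_rfl⟩
        · exact ⟨i', a', le_rfl, h⟩
      obtain ⟨se, n7, n8, n9⟩ : ∃ k, s < xl k ∧ hi k m ≤ hi j m ∧ hi k m ≤ hi q' m := by
        rcases le_total (hi j m) (hi q' m) with h | h
        · exact ⟨j, b, le_rfl, h⟩
        · exact ⟨q', b₂, h, le_rfl⟩
      obtain ⟨sw, m1, m2, m3⟩ : ∃ k, xr k < s ∧ hi k m ≤ hi j' m ∧ hi k m ≤ hi q m := by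
        rcases le_total (hi j' m) (hi q m) with h | h
        · exact ⟨j', b', le_rfl, h⟩
        · exact ⟨q, b₁, h, le_rfl⟩
      obtain ⟨r, hr1, hr2⟩ : ∃ r, max (hi se m) (hi sw m) < r ∧ r < min (lo ne m) (lo nw m) := by
        apply exists_between
        simp only [max_lt_iff, lt_min_iff]
        refine ⟨⟨?_, ?_⟩, ?_, ?_⟩ <;> linarith
      simp only [max_lt_iff, lt_min_iff] at hr1 hr2
      exact noAll s r m ne se nw sw n1 hr2.1 n7 hr1.1 n4 hr2.2 m1 hr1.2
  have hPne : ∃ m, TypeR (LE' xl lo hi) (LW xr lo hi) (LP xl xr lo hi) m := by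
    obtain ⟨m, hm⟩ := asB.exists
    refine ⟨m, (main m).1.resolve_right ?_⟩
    rintro ⟨s₁, s₂, h, -, -, hQ⟩
    obtain ⟨i, j, a, b, c⟩ := hQ s₁ ⟨le_rfl, h⟩
    linarith [hm j i (by linarith), hl i m, hl j m]
  have hQne : ∃ m, TypeR (LE' xl lo hi) (LW xr lo hi) (LQ xl xr lo hi) m := by
    obtain ⟨m, hm⟩ := asT.exists
    refine ⟨m, (main m).1.resolve_left ?_⟩
    rintro ⟨s₁, s₂, h, -, -, hQ⟩
    obtain ⟨i, j, a, b, c⟩ := hQ s₁ ⟨le_rfl, h⟩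
    linarith [hm i j (by linarith), hl i m, hl j m]
  obtain ⟨m, -, hm⟩ := (isPreconnected_univ (α := ℝ)) _ _ (typeR_open oE oW oP)
    (typeR_open oE oW oQ) (fun m _ => (main m).1) 
    (hPne.imp fun _ h => ⟨trivial, h⟩) (hQne.imp fun _ h => ⟨trivial, h⟩)
  exact (main m).2 hm

end core

lemma slope_cont (m : ℝ) : Continuous (fun x : Plane => x 1 - m * x 0) := by fun_prop

noncomputable def Lo (S : Set Plane) (f : Plane → ℝ) : ℝ := sInf (f '' S)
noncomputable def Hi (S : Set Plane) (f : Plane → ℝ) : ℝ := sSup (f '' S)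

lemma Lo_mem {S : Set Plane} {f : Plane → ℝ} (h : IsCompact S) (hn : S.Nonempty)
    (hf : Continuous f) : ∃ x ∈ S, f x = Lo S f :=
  (h.image hf).sInf_mem (hn.image f)

lemma Hi_mem {S : Set Plane} {f : Plane → ℝ} (h : IsCompact S) (hn : S.Nonempty)
    (hf : Continuous f) : ∃ x ∈ S, f x = Hi S f :=
  (h.image hf).sSup_mem (hn.image f)

lemma Lo_le {S : Set Plane} {f : Plane → ℝ} (h : IsCompact S)
    (hf : Continuous f) {x : Plane} (hx : x ∈ S) : Lo S f ≤ f x :=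
  csInf_le (h.image hf).bddBelow ⟨x, hx, rfl⟩

lemma le_Hi {S : Set Plane} {f : Plane → ℝ} (h : IsCompact S)
    (hf : Continuous f) {x : Plane} (hx : x ∈ S) : f x ≤ Hi S f :=
  le_csSup (h.image hf).bddAbove ⟨x, hx, rfl⟩

lemma hit_of_between {S : Set Plane} {f : Plane → ℝ} (h : IsCompact S) (hn : S.Nonempty)
    (hc : Convex ℝ S) (hf : Continuous f) {c : ℝ} (h1 : Lo S f ≤ c) (h2 : c ≤ Hi S f) :
    ∃ x ∈ S, f x = c := by
  obtain ⟨p, hp, hp'⟩ := Lo_mem h hn hf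
  obtain ⟨q, hq, hq'⟩ := Hi_mem h hn hf
  exact hc.isPreconnected.intermediate_value hp hq hf.continuousOn
    ⟨hp'.trans_le h1, h2.trans_eq hq'.symm⟩

lemma line_quadrants {l : Set Plane} (hl : IsLine l) (s c m : ℝ) {p₁ p₂ p₃ p₄ : Plane}
    (h₁ : p₁ ∈ l) (h₂ : p₂ ∈ l) (h₃ : p₃ ∈ l) (h₄ : p₄ ∈ l)
    (a₁ : s < p₁ 0) (b₁ : c < p₁ 1 - m * p₁ 0)
    (a₂ : s < p₂ 0) (b₂ : p₂ 1 - m * p₂ 0 < c)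
    (a₃ : p₃ 0 < s) (b₃ : c < p₃ 1 - m * p₃ 0)
    (a₄ : p₄ 0 < s) (b₄ : p₄ 1 - m * p₄ 0 < c) : False := by
  obtain ⟨p, v, -, rfl⟩ := hl
  obtain ⟨t₁, rfl⟩ := h₁
  obtain ⟨t₂, rfl⟩ := h₂
  obtain ⟨t₃, rfl⟩ := h₃
  obtain ⟨t₄, rfl⟩ := h₄
  simp only [PiLp.add_apply, PiLp.smul_apply, smul_eq_mul] at *
  have e1 : 0 < (t₁ - t₄) * v 0 := by linarith
  have e2 : 0 < (t₁ - t₄) * (v 1 - m * v 0) := by linarith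
  have e3 : 0 < (t₂ - t₃) * v 0 := by linarith
  have e4 : 0 < (t₃ - t₂) * (v 1 - m * v 0) := by linarith
  have f1 := mul_pos e1 e2
  have f2 := mul_pos e3 e4
  have g1 : 0 < v 0 * (v 1 - m * v 0) := by
    by_contra h
    nlinarith [mul_nonneg (sq_nonneg (t₁ - t₄)) (neg_nonneg.2 (not_lt.1 h))]
  nlinarith [mul_nonneg (sq_nonneg (t₂ - t₃)) g1.le]

lemma eventually_big (a B : ℝ) (ha : 0 < a) : ∀ᶠ m : ℝ in atTop, 0 ≤ m ∧ B < m * a := by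
  have := (tendsto_id.atTop_mul_const ha : Tendsto (fun m : ℝ => m * a) atTop atTop)
  exact (eventually_ge_atTop 0).and (this.eventually_gt_atTop B)

lemma eventually_sep {A B : Set Plane} (hA : IsCompact A) (hB : IsCompact B)
    (nA : A.Nonempty) (nB : B.Nonempty) (h : Hi B (fun x => x 0) < Lo A (fun x => x 0)) :
    ∀ᶠ m : ℝ in atTop, Hi B (fun x => x 1 - (-m) * x 0) < Lo A (fun x => x 1 - (-m) * x 0) ∧
      Hi A (fun x => x 1 - m * x 0) < Lo B (fun x => x 1 - m * x 0) := by
  have c0 : Continuous (fun x : Plane => x 0) := by fun_prop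
  have c1 : Continuous (fun x : Plane => x 1) := by fun_prop
  filter_upwards [eventually_big _ (Hi B (fun x => x 1) - Lo A (fun x => x 1)) (sub_pos.2 h),
    eventually_big _ (Hi A (fun x => x 1) - Lo B (fun x => x 1)) (sub_pos.2 h)]
    with m ⟨hm, h1⟩ ⟨_, h2⟩
  constructor
  · obtain ⟨p, hp, hp'⟩ := Hi_mem hB nB (slope_cont (-m))
    obtain ⟨q, hq, hq'⟩ := Lo_mem hA nA (slope_cont (-m))
    rw [← hp', ← hq']
    have := mul_le_mul_of_nonneg_left (le_Hi hB c0 hp) hm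
    have := mul_le_mul_of_nonneg_left (Lo_le hA c0 hq) hm
    linarith [le_Hi hB c1 hp, Lo_le hA c1 hq]
  · obtain ⟨p, hp, hp'⟩ := Hi_mem hA nA (slope_cont m)
    obtain ⟨q, hq, hq'⟩ := Lo_mem hB nB (slope_cont m)
    rw [← hp', ← hq']
    have := mul_le_mul_of_nonneg_left (le_Hi hB c0 hq) hm
    have := mul_le_mul_of_nonneg_left (Lo_le hA c0 hp) hm
    linarith [le_Hi hA c1 hp, Lo_le hB c1 hq]

theorem finite_case (G : Set (Set Plane)) (hfin : G.Finite)
    (hne : ∀ S ∈ G, S.Nonempty)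
    (hcpt : ∀ S ∈ G, IsCompact S)
    (hconv : ∀ S ∈ G, Convex ℝ S)
    (hT4 : ∀ A ∈ G, ∀ B ∈ G, ∀ C ∈ G, ∀ D ∈ G, ∃ l : Set Plane, IsLine l ∧
      (A ∩ l).Nonempty ∧ (B ∩ l).Nonempty ∧ (C ∩ l).Nonempty ∧ (D ∩ l).Nonempty) :
    ∃ s m c : ℝ, ∀ S ∈ G, (∃ x ∈ S, x 0 = s) ∨ (∃ x ∈ S, x 1 - m * x 0 = c) := by
  have c0 : Continuous (fun x : Plane => x 0) := by fun_prop
  have : Finite G := hfin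
  have ev : ∀ᶠ m : ℝ in atTop, ∀ i j : G, Hi j.1 (fun x => x 0) < Lo i.1 (fun x => x 0) →
      Hi j.1 (fun x => x 1 - (-m) * x 0) < Lo i.1 (fun x => x 1 - (-m) * x 0) ∧
      Hi i.1 (fun x => x 1 - m * x 0) < Lo j.1 (fun x => x 1 - m * x 0) := by
    refine eventually_all.2 fun i => eventually_all.2 fun j => eventually_imp_distrib_left.2 ?_
    exact eventually_sep (hcpt _ i.2) (hcpt _ j.2) (hne _ i.2) (hne _ j.2)
  obtain ⟨s, m, c, h⟩ := core (ι := G) (fun S => Lo S.1 (fun x => x 0))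
    (fun S => Hi S.1 (fun x => x 0)) (fun S m => Lo S.1 (fun x => x 1 - m * x 0))
    (fun S m => Hi S.1 (fun x => x 1 - m * x 0))
    (fun S m => by
      obtain ⟨x, hx⟩ := hne _ S.2
      exact (Lo_le (hcpt _ S.2) (slope_cont m) hx).trans (le_Hi (hcpt _ S.2) (slope_cont m) hx))
    (fun S => (hcpt _ S.2).continuous_sInf (f := fun (m : ℝ) (x : Plane) => x 1 - m * x 0)
      (by fun_prop))
    (fun S => (hcpt _ S.2).continuous_sSup (f := fun (m : ℝ) (x : Plane) => x 1 - m * x 0)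
      (by fun_prop))
    (by
      filter_upwards [tendsto_neg_atBot_atTop.eventually ev] with m hm i j hij
      simpa only [neg_neg] using (hm i j hij).1)
    (by
      filter_upwards [ev] with m hm i j hij
      exact (hm i j hij).2)
    (by
      intro s c m i₁ i₂ i₃ i₄ a₁ b₁ a₂ b₂ a₃ b₃ a₄ b₄
      obtain ⟨l, hl, ⟨p₁, h₁, g₁⟩, ⟨p₂, h₂, g₂⟩, ⟨p₃, h₃, g₃⟩, ⟨p₄, h₄, g₄⟩⟩ :=
        hT4 _ i₁.2 _ i₂.2 _ i₃.2 _ i₄.2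
      exact line_quadrants hl s c m g₁ g₂ g₃ g₄
        (a₁.trans_le (Lo_le (hcpt _ i₁.2) c0 h₁))
        (b₁.trans_le (Lo_le (hcpt _ i₁.2) (slope_cont m) h₁))
        (a₂.trans_le (Lo_le (hcpt _ i₂.2) c0 h₂))
        ((le_Hi (hcpt _ i₂.2) (slope_cont m) h₂).trans_lt b₂)
        ((le_Hi (hcpt _ i₃.2) c0 h₃).trans_lt a₃)
        (b₃.trans_le (Lo_le (hcpt _ i₃.2) (slope_cont m) h₃))
        ((le_Hi (hcpt _ i₄.2) c0 h₄).trans_lt a₄)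
        ((le_Hi (hcpt _ i₄.2) (slope_cont m) h₄).trans_lt b₄))
  refine ⟨s, m, c, fun S hS => ?_⟩
  rcases h ⟨S, hS⟩ with ⟨a, b⟩ | ⟨a, b⟩
  · exact Or.inl (hit_of_between (hcpt _ hS) (hne _ hS) (hconv _ hS) c0 a b)
  · exact Or.inr (hit_of_between (hcpt _ hS) (hne _ hS) (hconv _ hS) (slope_cont m) a b)

/-- the line with parameters `q` meets `S` -/
def Hit (q : ℝ × ℝ × ℝ) (S : Set Plane) : Prop := ∃ x ∈ S, q.1 * x 0 + q.2.1 * x 1 = q.2.2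

def Norm1 (q : ℝ × ℝ × ℝ) : Prop := q.1 ^ 2 + q.2.1 ^ 2 = 1

lemma isClosed_hit {S : Set Plane} (hS : IsCompact S) : IsClosed {q | Hit q S} := by
  have : CompactSpace S := isCompact_iff_compactSpace.1 hS
  have h1 : IsClosed {z : S × (ℝ × ℝ × ℝ) |
      z.2.1 * z.1.1 0 + z.2.2.1 * z.1.1 1 = z.2.2.2} :=
    isClosed_eq (by fun_prop) (by fun_prop)
  have h2 := isClosedMap_snd_of_compactSpace _ h1
  convert h2 using 1
  ext q
  constructor
  · rintro ⟨x, hx, h⟩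
    exact ⟨(⟨x, hx⟩, q), h, rfl⟩
  · rintro ⟨⟨x, q'⟩, h, rfl⟩
    exact ⟨x.1, x.2, h⟩

def KK (R : ℝ) : Set (ℝ × ℝ × ℝ) := {q | Norm1 q ∧ |q.2.2| ≤ R}

lemma isCompact_KK (R : ℝ) : IsCompact (KK R) := by
  have hc : IsCompact (Icc (-1 : ℝ) 1 ×ˢ (Icc (-1 : ℝ) 1 ×ˢ Icc (-R) R)) :=
    isCompact_Icc.prod (isCompact_Icc.prod isCompact_Icc)
  refine hc.of_isClosed_subset ?_ ?_
  · have a1 : IsClosed {q : ℝ × ℝ × ℝ | q.1 ^ 2 + q.2.1 ^ 2 = 1} :=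
      isClosed_eq (by fun_prop) (by fun_prop)
    have a2 : IsClosed {q : ℝ × ℝ × ℝ | |q.2.2| ≤ R} :=
      isClosed_le (by fun_prop) (by fun_prop)
    exact a1.inter a2
  · rintro ⟨a, b, r⟩ ⟨h1, h2⟩
    simp only [Norm1] at h1 h2
    refine ⟨abs_le.1 ?_, abs_le.1 ?_, abs_le.1 h2⟩
    · exact abs_le_one_iff_mul_self_le_one.2 (by nlinarith [sq_nonneg b])
    · exact abs_le_one_iff_mul_self_le_one.2 (by nlinarith [sq_nonneg a])

lemma bound_KK {T : Set Plane} (hT : IsCompact T) :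
    ∃ R, ∀ q, Norm1 q → Hit q T → q ∈ KK R := by
  obtain ⟨B, hB⟩ := (hT.image (f := fun x : Plane => |x 0| + |x 1|) (by fun_prop)).bddAbove
  refine ⟨B, ?_⟩
  rintro ⟨a, b, r⟩ h ⟨x, hx, hr⟩
  refine ⟨h, ?_⟩
  simp only [Norm1] at h hr ⊢
  have h1 : |a| ≤ 1 := abs_le_one_iff_mul_self_le_one.2 (by nlinarith [sq_nonneg b])
  have h2 : |b| ≤ 1 := abs_le_one_iff_mul_self_le_one.2 (by nlinarith [sq_nonneg a])
  have h3 : |x 0| + |x 1| ≤ B := hB ⟨x, hx, rfl⟩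
  rw [← hr]
  refine (abs_add_le _ _).trans ?_
  rw [abs_mul, abs_mul]
  nlinarith [abs_nonneg (x 0), abs_nonneg (x 1)]

lemma isLine_of_norm1 {q : ℝ × ℝ × ℝ} (h : Norm1 q) :
    IsLine {x : Plane | q.1 * x 0 + q.2.1 * x 1 = q.2.2} := by
  obtain ⟨a, b, r⟩ := q
  simp only [Norm1] at h ⊢
  refine ⟨!₂[r * a, r * b], !₂[-b, a], ?_, ?_⟩
  · intro h0
    have e0 := congrArg (fun x : Plane => x 0) h0
    have e1 := congrArg (fun x : Plane => x 1) h0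
    simp at e0 e1
    subst e0 e1
    norm_num at h
  · ext x
    constructor
    · intro hx
      change a * x 0 + b * x 1 = r at hx
      refine ⟨-b * x 0 + a * x 1, ?_⟩
      ext i
      fin_cases i
      · simp
        rw [← hx]
        linear_combination (-x 0) * h
      · simp
        rw [← hx]
        linear_combination (-x 1) * h
    · rintro ⟨t, rfl⟩
      change a * _ + b * _ = r
      simp
      linear_combination r * h

theorem finite_case' (G : Set (Set Plane)) (hfin : G.Finite)
    (hne : ∀ S ∈ G, S.Nonempty)
    (hcpt : ∀ S ∈ G, IsCompact S)
    (hconv : ∀ S ∈ G, Convex ℝ S)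
    (hT4 : ∀ A ∈ G, ∀ B ∈ G, ∀ C ∈ G, ∀ D ∈ G, ∃ l : Set Plane, IsLine l ∧
      (A ∩ l).Nonempty ∧ (B ∩ l).Nonempty ∧ (C ∩ l).Nonempty ∧ (D ∩ l).Nonempty) :
    ∃ q₁ q₂, Norm1 q₁ ∧ Norm1 q₂ ∧ ∀ S ∈ G, Hit q₁ S ∨ Hit q₂ S := by
  obtain ⟨s, m, c, h⟩ := finite_case G hfin hne hcpt hconv hT4
  have hk : 0 < √(1 + m ^ 2) := Real.sqrt_pos.2 (by positivity)
  have hk2 : √(1 + m ^ 2) ^ 2 = 1 + m ^ 2 := Real.sq_sqrt (by positivity)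
  set k := √(1 + m ^ 2)
  refine ⟨(1, 0, s), (-m / k, 1 / k, c / k), by simp [Norm1], ?_, fun S hS => ?_⟩
  · simp only [Norm1]
    field_simp
    rw [hk2]; ring
  · rcases h S hS with ⟨x, hx, e⟩ | ⟨x, hx, e⟩
    · exact Or.inl ⟨x, hx, by simpa using e⟩
    · refine Or.inr ⟨x, hx, ?_⟩
      simp only
      rw [← e]
      field_simp
      ring

theorem stmt_6 (F : Set (Set Plane))
    (hne : ∀ S ∈ F, S.Nonempty)
    (hcpt : ∀ S ∈ F, IsCompact S)
    (hconv : ∀ S ∈ F, Convex ℝ S)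
    (hT4 : ∀ A ∈ F, ∀ B ∈ F, ∀ C ∈ F, ∀ D ∈ F, ∃ l : Set Plane, IsLine l ∧
      (A ∩ l).Nonempty ∧ (B ∩ l).Nonempty ∧ (C ∩ l).Nonempty ∧ (D ∩ l).Nonempty) :
    PiercedByLines F 2 := by
  classical
  have fin : ∀ G ⊆ F, G.Finite → ∃ q₁ q₂, Norm1 q₁ ∧ Norm1 q₂ ∧ ∀ S ∈ G, Hit q₁ S ∨ Hit q₂ S :=
    fun G hG hf => finite_case' G hf (fun S h => hne S (hG h)) (fun S h => hcpt S (hG h))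
      (fun S h => hconv S (hG h))
      (fun A hA B hB C hC D hD => hT4 A (hG hA) B (hG hB) C (hG hC) D (hG hD))
  have bdd : ∃ R, ∀ G ⊆ F, G.Finite → ∃ q₁ ∈ KK R, ∃ q₂ ∈ KK R, ∀ S ∈ G, Hit q₁ S ∨ Hit q₂ S := by
    by_cases hs : ∀ G ⊆ F, G.Finite → ∃ q, Norm1 q ∧ ∀ S ∈ G, Hit q S
    · rcases F.eq_empty_or_nonempty with rfl | ⟨A, hA⟩
      · refine ⟨0, fun G hG _ => ⟨(1, 0, 0), by simp [KK, Norm1], (1, 0, 0), by simp [KK, Norm1],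
          fun S hS => absurd (hG hS) (notMem_empty _)⟩⟩
      obtain ⟨R, hR⟩ := bound_KK (hcpt A hA)
      refine ⟨R, fun G hG hf => ?_⟩
      obtain ⟨q, hq, h⟩ := hs (insert A G) (insert_subset hA hG) (hf.insert A)
      have := hR q hq (h A (mem_insert _ _))
      exact ⟨q, this, q, this, fun S hS => Or.inl (h S (mem_insert_of_mem _ hS))⟩
    · push Not at hs
      obtain ⟨G₀, hG₀, hf₀, hno⟩ := hs
      obtain ⟨R, hR⟩ := bound_KK (hf₀.isCompact_sUnion fun S hS => hcpt S (hG₀ hS))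
      have hR' : ∀ q, Norm1 q → ∀ S ∈ G₀, Hit q S → q ∈ KK R := fun q hq S hS ⟨x, hx, h⟩ =>
        hR q hq ⟨x, mem_sUnion.2 ⟨S, hS, hx⟩, h⟩
      refine ⟨R, fun G hG hf => ?_⟩
      obtain ⟨q₁, q₂, h1, h2, h⟩ := fin (G ∪ G₀) (union_subset hG hG₀) (hf.union hf₀)
      obtain ⟨S, hS, n1⟩ := hno q₁ h1
      obtain ⟨T, hT, n2⟩ := hno q₂ h2
      exact ⟨q₁, hR' q₁ h1 T hT ((h T (Or.inr hT)).resolve_right n2),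
        q₂, hR' q₂ h2 S hS ((h S (Or.inr hS)).resolve_left n1), fun U hU => h U (Or.inl hU)⟩
  obtain ⟨R, hR⟩ := bdd
  obtain ⟨⟨q₁, q₂⟩, ⟨h1, h2⟩, h⟩ := ((isCompact_KK R).prod (isCompact_KK R)).inter_iInter_nonempty
    (fun S : F => {z : (ℝ × ℝ × ℝ) × (ℝ × ℝ × ℝ) | Hit z.1 S.1 ∨ Hit z.2 S.1})
    (fun S => ((isClosed_hit (hcpt _ S.2)).preimage continuous_fst).union
      ((isClosed_hit (hcpt _ S.2)).preimage continuous_snd))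
    (fun u => by
      obtain ⟨q₁, h1, q₂, h2, h⟩ := hR (Subtype.val '' (u : Set F))
        (by rintro _ ⟨S, -, rfl⟩; exact S.2) (u.finite_toSet.image _)
      refine ⟨(q₁, q₂), ⟨h1, h2⟩, mem_iInter₂.2 fun S hS => h S.1 ⟨S, hS, rfl⟩⟩)
  refine ⟨![{x : Plane | q₁.1 * x 0 + q₁.2.1 * x 1 = q₁.2.2},
    {x : Plane | q₂.1 * x 0 + q₂.2.1 * x 1 = q₂.2.2}], ?_, fun S hS => ?_⟩
  · intro i
    fin_cases i
    · exact isLine_of_norm1 h1.1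
    · exact isLine_of_norm1 h2.1
  · rcases mem_iInter.1 h ⟨S, hS⟩ with ⟨x, hx, e⟩ | ⟨x, hx, e⟩
    · exact ⟨x, hx, mem_iUnion.2 ⟨0, e⟩⟩
    · exact ⟨x, hx, mem_iUnion.2 ⟨1, e⟩⟩
end
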